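/- arXiv:1402.4169 — 4 statements merged into one kernel-verified Lean document; each statement's English description precedes it below -/
import Mathlib

section
/- Let u ∈ V, let s ∈ V, and let {x,y} ∈ E. For a spanning tree T of G, say that T traverses (x,y) if on the unique path in (V,T) from u to s the vertex x appears and is immediately followed by y. Then (Σ_{T traverses (x,y)} w(T)) − (Σ_{T traverses (y,x)} w(T)) = w(x,y) · (G^{(s)}_{u,x} − G^{(s)}_{u,y}) · F₁(G), where w(T) is the weight of the tree T and F₁(G) is the weighted sum of all spanning trees. -/
open scoped Classical

/-- The weighted Laplacian of `w` on a finite vertex set. -/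
noncomputable def lap {V : Type*} [Fintype V] [DecidableEq V] (w : V → V → ℝ) :
    Matrix V V ℝ :=
  Matrix.of fun u v =>
    if u = v then ∑ x ∈ Finset.univ.filter (fun x => x ≠ u), w u x else -(w u v)

/-- The Green's function with Dirichlet boundary condition at `s`. -/
noncomputable def green {V : Type*} [Fintype V] [DecidableEq V]
    (w : V → V → ℝ) (s u v : V) : ℝ :=
  if hu : u = s then 0
  else if hv : v = s then 0
  else (((lap w).submatrix (Subtype.val : {x : V // x ≠ s} → V) Subtype.val)⁻¹)
      (⟨u, hu⟩ : {x : V // x ≠ s}) (⟨v, hv⟩ : {x : V // x ≠ s})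

/-- `T` is a spanning tree of `G`. -/
def IsSpanningTree {V : Type*} (G : SimpleGraph V) (T : Finset (Sym2 V)) : Prop :=
  (T : Set (Sym2 V)) ⊆ G.edgeSet ∧
  (SimpleGraph.fromEdgeSet (T : Set (Sym2 V))).Connected ∧
  (SimpleGraph.fromEdgeSet (T : Set (Sym2 V))).IsAcyclic

/-- The spanning tree `T` traverses the ordered edge `(x,y)`: on the unique path in
`(V,T)` from `u` to `s`, the vertex `x` appears immediately followed by `y`. -/
def Traverses {V : Type*} (T : Finset (Sym2 V)) (u s x y : V) : Prop :=
  ∃ p : (SimpleGraph.fromEdgeSet (T : Set (Sym2 V))).Walk u s,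
    p.IsPath ∧ [x, y] <:+: p.support

namespace SimpleGraph

variable {V : Type*}

/-- Removing the edge `ab`, crossed from `a` to `b` by a path from `u` to `s`, leaves `u` connected
to `a` and `b` connected to `s`. -/
lemma Walk.IsPath.reachable_deleteEdges_of_infix {K : SimpleGraph V} {u s a b : V}
    {p : K.Walk u s} (hp : p.IsPath) (h : [a, b] <:+: p.support) :
    (K.deleteEdges {s(a, b)}).Reachable u a ∧ (K.deleteEdges {s(a, b)}).Reachable b s := by
  induction p with
  | nil => simpa using h.length_le
  | @cons u v s huv p ih =>
    rw [Walk.cons_isPath_iff] at hp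
    rw [Walk.support_cons, List.infix_cons_iff] at h
    rcases h with h | h
    · rw [← Walk.cons_tail_support p] at h
      obtain ⟨rfl, h'⟩ := List.cons_prefix_cons.1 h
      obtain ⟨rfl, -⟩ := List.cons_prefix_cons.1 h'
      clear h h'
      refine ⟨Reachable.refl _, ?_⟩
      rw [reachable_deleteEdges_iff_exists_walk]
      exact ⟨p, fun he => hp.2 (p.fst_mem_support_of_mem_edges he)⟩
    · obtain ⟨h₁, h₂⟩ := ih hp.1 h
      have ha : a ∈ p.support := h.subset (by simp)
      have hb : b ∈ p.support := h.subset (by simp)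
      refine ⟨Reachable.trans (Adj.reachable ?_) h₁, h₂⟩
      rw [deleteEdges_adj]
      refine ⟨huv, fun he => ?_⟩
      simp only [Set.mem_singleton_iff, Sym2.eq_iff] at he
      rcases he with ⟨rfl, -⟩ | ⟨rfl, -⟩
      exacts [hp.2 ha, hp.2 hb]

/-- After deleting the edge `ab`, a vertex that could reach `a` still reaches `a` or `b`. -/
lemma Reachable.deleteEdges_or {K : SimpleGraph V} {v a : V} (b : V) (h : K.Reachable v a) :
    (K.deleteEdges {s(a, b)}).Reachable v a ∨ (K.deleteEdges {s(a, b)}).Reachable v b := by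
  obtain ⟨p⟩ := h
  induction p with
  | nil => exact Or.inl (Reachable.refl _)
  | @cons v x a hvx p ih =>
    by_cases he : s(v, x) = s(a, b)
    · rcases Sym2.eq_iff.1 he with ⟨rfl, -⟩ | ⟨rfl, -⟩
      exacts [Or.inl (Reachable.refl _), Or.inr (Reachable.refl _)]
    · have hadj : (K.deleteEdges {s(a, b)}).Adj v x := by
        rw [deleteEdges_adj]
        exact ⟨hvx, he⟩
      exact ih.imp hadj.reachable.trans hadj.reachable.trans

/-- Two paths in different components of a subgraph are joined by an edge into a path. -/
lemma exists_isPath_infix_of_not_reachable {H K : SimpleGraph V} (hHK : H ≤ K) {u s a b : V}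
    (hua : H.Reachable u a) (hbs : H.Reachable b s) (hus : ¬ H.Reachable u s) (hab : K.Adj a b) :
    ∃ p : K.Walk u s, p.IsPath ∧ [a, b] <:+: p.support := by
  obtain ⟨p, hp⟩ := hua.exists_isPath
  obtain ⟨q, hq⟩ := hbs.exists_isPath
  refine ⟨((p.mapLe hHK).concat hab).append (q.mapLe hHK), ?_, ?_⟩
  · have hsupp : (((p.mapLe hHK).concat hab).append (q.mapLe hHK)).support
        = p.support ++ q.support := by
      rw [Walk.support_append, Walk.support_concat]
      simp only [Walk.support_mapLe_eq_support, List.append_assoc]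
      rw [← Walk.cons_tail_support q]
      simp
    rw [Walk.isPath_def, hsupp, List.nodup_append]
    refine ⟨hp.support_nodup, hq.support_nodup, ?_⟩
    rintro c hc d hd rfl
    exact hus ((p.takeUntil c hc).reachable.trans (q.dropUntil c hd).reachable)
  · rw [← Walk.mem_darts_iff_infix_support hab]
    simp [Walk.darts_append]

/-- The net number of times a path from `u` to `s` leaves a vertex `a`. -/
lemma Walk.IsPath.sum_infix_sub_infix [Fintype V] {K : SimpleGraph V} {u s : V}
    {p : K.Walk u s} (hp : p.IsPath) (a : V) :
    ∑ b, ((if [a, b] <:+: p.support then (1 : ℝ) else 0)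
        - if [b, a] <:+: p.support then 1 else 0)
      = (if a = u then 1 else 0) - if a = s then 1 else 0 := by
  induction p with
  | nil =>
    have h (c d x : V) : ¬ [c, d] <:+: [x] := fun h => by simpa using h.length_le
    simp [h]
  | @cons u v s huv p ih =>
    rw [Walk.cons_isPath_iff] at hp
    have key (c d : V) : (if [c, d] <:+: (Walk.cons huv p).support then (1 : ℝ) else 0)
        = (if c = u ∧ d = v then 1 else 0) + if [c, d] <:+: p.support then 1 else 0 := by
      have h₁ : [c, d] <:+: (Walk.cons huv p).support
          ↔ (c = u ∧ d = v) ∨ [c, d] <:+: p.support := by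
        rw [Walk.support_cons, List.infix_cons_iff]
        refine or_congr ?_ Iff.rfl
        rw [← Walk.cons_tail_support p]
        simp only [List.cons_prefix_cons, List.nil_prefix, and_true]
      by_cases h : [c, d] <:+: p.support
      · have hc : c ≠ u := by
          rintro rfl
          exact hp.2 (h.subset (by simp))
        simp only [h₁]
        simp [h, hc]
      · simp only [h₁]
        simp [h]
    have e₁ : ∑ b, (if a = u ∧ b = v then (1 : ℝ) else 0) = if a = u then 1 else 0 := by
      by_cases h : a = u <;> simp [h]
    have e₂ : ∑ b, (if b = u ∧ a = v then (1 : ℝ) else 0) = if a = v then 1 else 0 := by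
      by_cases h : a = v <;> simp [h]
    have := ih hp.1
    simp only [Finset.sum_sub_distrib] at this ⊢
    simp only [key, Finset.sum_add_distrib, e₁, e₂]
    linarith

end SimpleGraph

/-- `F` is a forest of `G` with exactly two components, one containing `u` and the other `s`. -/
def IsTwoForest {V : Type*} (G : SimpleGraph V) (u s : V) (F : Finset (Sym2 V)) : Prop :=
  (F : Set (Sym2 V)) ⊆ G.edgeSet ∧
  (SimpleGraph.fromEdgeSet (F : Set (Sym2 V))).IsAcyclic ∧
  ¬ (SimpleGraph.fromEdgeSet (F : Set (Sym2 V))).Reachable u s ∧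
  ∀ v, (SimpleGraph.fromEdgeSet (F : Set (Sym2 V))).Reachable v u ∨
    (SimpleGraph.fromEdgeSet (F : Set (Sym2 V))).Reachable v s

/-- The weighted sum of the two-component forests of `G` in which `u` and `a` are in the same
component and `s` is in the other one. -/
noncomputable def twoForestSum {V : Type*} [Fintype V] [DecidableEq V] (G : SimpleGraph V)
    (f : Sym2 V → ℝ) (s u a : V) : ℝ :=
  ∑ F ∈ Finset.univ.filter (fun F : Finset (Sym2 V) => IsTwoForest G u s F ∧
    (SimpleGraph.fromEdgeSet (F : Set (Sym2 V))).Reachable u a), ∏ e ∈ F, f e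

/-- The weighted sum of the spanning trees of `G` whose path from `u` to `s` crosses `(a, b)`. -/
noncomputable def traverseSum {V : Type*} [Fintype V] [DecidableEq V] (G : SimpleGraph V)
    (f : Sym2 V → ℝ) (u s a b : V) : ℝ :=
  ∑ T ∈ Finset.univ.filter (fun T : Finset (Sym2 V) => IsSpanningTree G T ∧ Traverses T u s a b),
    ∏ e ∈ T, f e

section

variable {V : Type*} {G : SimpleGraph V} {u s a b : V}

lemma Traverses.mem {T : Finset (Sym2 V)} (h : Traverses T u s a b) : s(a, b) ∈ T := by
  obtain ⟨p, -, h⟩ := h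
  have := p.adj_of_infix_support h
  rw [SimpleGraph.fromEdgeSet_adj] at this
  exact this.1

lemma IsSpanningTree.isTwoForest_erase [DecidableEq V] {T : Finset (Sym2 V)}
    (hT : IsSpanningTree G T) (h : Traverses T u s a b) :
    IsTwoForest G u s (T.erase s(a, b)) ∧
      (SimpleGraph.fromEdgeSet ((T.erase s(a, b) : Finset (Sym2 V)) : Set (Sym2 V))).Reachable u a ∧
      (SimpleGraph.fromEdgeSet ((T.erase s(a, b) : Finset (Sym2 V)) : Set (Sym2 V))).Reachable b s := by
  obtain ⟨hsub, hconn, hacyc⟩ := hT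
  obtain ⟨p, hp, hinf⟩ := h
  obtain ⟨hua, hbs⟩ := hp.reachable_deleteEdges_of_infix hinf
  have hadj := p.adj_of_infix_support hinf
  have hbr := SimpleGraph.isAcyclic_iff_forall_adj_isBridge.1 hacyc hadj
  rw [SimpleGraph.isBridge_iff] at hbr
  have heq : SimpleGraph.fromEdgeSet ((T.erase s(a, b) : Finset (Sym2 V)) : Set (Sym2 V))
      = (SimpleGraph.fromEdgeSet (T : Set (Sym2 V))).deleteEdges {s(a, b)} := by
    rw [Finset.coe_erase, SimpleGraph.deleteEdges_fromEdgeSet]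
  unfold IsTwoForest
  rw [heq]
  refine ⟨⟨?_, hacyc.anti (SimpleGraph.deleteEdges_le _), ?_, fun v => ?_⟩, hua, hbs⟩
  · exact fun e he => hsub (Finset.mem_of_mem_erase he)
  · exact fun hus => hbr ((hua.symm.trans hus).trans hbs.symm)
  · exact ((hconn.preconnected v a).deleteEdges_or b).imp (·.trans hua.symm) (·.trans hbs)

lemma IsTwoForest.isSpanningTree_insert [DecidableEq V] {F : Finset (Sym2 V)}
    (hF : IsTwoForest G u s F) (hab : G.Adj a b)
    (hua : (SimpleGraph.fromEdgeSet (F : Set (Sym2 V))).Reachable u a)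
    (hbs : (SimpleGraph.fromEdgeSet (F : Set (Sym2 V))).Reachable b s) :
    s(a, b) ∉ F ∧ IsSpanningTree G (insert s(a, b) F) ∧
      Traverses (insert s(a, b) F) u s a b := by
  obtain ⟨hsub, hacyc, hus, hcov⟩ := hF
  have hnab : ¬ (SimpleGraph.fromEdgeSet (F : Set (Sym2 V))).Reachable a b :=
    fun h => hus ((hua.trans h).trans hbs)
  have heq : SimpleGraph.fromEdgeSet ((insert s(a, b) F : Finset (Sym2 V)) : Set (Sym2 V))
      = SimpleGraph.fromEdgeSet (F : Set (Sym2 V)) ⊔ SimpleGraph.edge a b := by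
    rw [Finset.coe_insert, Set.insert_eq, SimpleGraph.fromEdgeSet_union, sup_comm]
    rfl
  have hle : SimpleGraph.fromEdgeSet (F : Set (Sym2 V))
      ≤ SimpleGraph.fromEdgeSet ((insert s(a, b) F : Finset (Sym2 V)) : Set (Sym2 V)) :=
    SimpleGraph.fromEdgeSet_mono (by simp)
  have hadj : (SimpleGraph.fromEdgeSet
      ((insert s(a, b) F : Finset (Sym2 V)) : Set (Sym2 V))).Adj a b := by
    simp [hab.ne]
  refine ⟨fun h => hnab (SimpleGraph.Adj.reachable ?_), ⟨?_, ?_, ?_⟩,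
    SimpleGraph.exists_isPath_infix_of_not_reachable hle hua hbs hus hadj⟩
  · simpa [hab.ne] using h
  · rw [Finset.coe_insert, Set.insert_subset_iff]
    exact ⟨hab, hsub⟩
  · have hus' := ((hua.mono hle).trans hadj.reachable).trans (hbs.mono hle)
    have hall v : (SimpleGraph.fromEdgeSet
        ((insert s(a, b) F : Finset (Sym2 V)) : Set (Sym2 V))).Reachable v s :=
      (hcov v).elim (fun h => (h.mono hle).trans hus') (·.mono hle)
    have : Nonempty V := ⟨u⟩
    exact ⟨fun v v' => (hall v).trans (hall v').symm⟩
  · rw [heq]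
    exact hacyc.sup_edge_of_not_reachable hnab

lemma traverseSum_eq [Fintype V] [DecidableEq V] (f : Sym2 V → ℝ) (hab : G.Adj a b) :
    traverseSum G f u s a b = f s(a, b) *
      ∑ F ∈ Finset.univ.filter (fun F : Finset (Sym2 V) => IsTwoForest G u s F ∧
        (SimpleGraph.fromEdgeSet (F : Set (Sym2 V))).Reachable u a ∧
        (SimpleGraph.fromEdgeSet (F : Set (Sym2 V))).Reachable b s), ∏ e ∈ F, f e := by
  rw [traverseSum, Finset.mul_sum]
  refine Finset.sum_bij' (fun T _ => T.erase s(a, b)) (fun F _ => insert s(a, b) F) ?_ ?_ ?_ ?_ ?_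
  · intro T hT
    simp only [Finset.mem_filter, Finset.mem_univ, true_and] at hT ⊢
    exact hT.1.isTwoForest_erase hT.2
  · intro F hF
    simp only [Finset.mem_filter, Finset.mem_univ, true_and] at hF ⊢
    exact (hF.1.isSpanningTree_insert hab hF.2.1 hF.2.2).2
  · intro T hT
    simp only [Finset.mem_filter, Finset.mem_univ, true_and] at hT
    exact Finset.insert_erase hT.2.mem
  · intro F hF
    simp only [Finset.mem_filter, Finset.mem_univ, true_and] at hF
    exact Finset.erase_insert (hF.1.isSpanningTree_insert hab hF.2.1 hF.2.2).1
  · intro T hT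
    simp only [Finset.mem_filter, Finset.mem_univ, true_and] at hT
    exact (Finset.mul_prod_erase T f hT.2.mem).symm

/-- The forests counted by `twoForestSum G f s u a`, split by the component containing `b`. -/
lemma twoForestSum_eq_add [Fintype V] [DecidableEq V] (f : Sym2 V → ℝ) (b : V) :
    twoForestSum G f s u a =
      ∑ F ∈ Finset.univ.filter (fun F : Finset (Sym2 V) => IsTwoForest G u s F ∧
        (SimpleGraph.fromEdgeSet (F : Set (Sym2 V))).Reachable u a ∧
        (SimpleGraph.fromEdgeSet (F : Set (Sym2 V))).Reachable b s), ∏ e ∈ F, f e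
      + ∑ F ∈ Finset.univ.filter (fun F : Finset (Sym2 V) => IsTwoForest G u s F ∧
        (SimpleGraph.fromEdgeSet (F : Set (Sym2 V))).Reachable u a ∧
        (SimpleGraph.fromEdgeSet (F : Set (Sym2 V))).Reachable u b), ∏ e ∈ F, f e := by
  rw [twoForestSum, ← Finset.sum_filter_add_sum_filter_not _ (fun F : Finset (Sym2 V) =>
    (SimpleGraph.fromEdgeSet (F : Set (Sym2 V))).Reachable b s), Finset.filter_filter,
    Finset.filter_filter]
  congr 1
  · simp only [and_assoc]
  · refine Finset.sum_congr (Finset.filter_congr fun F _ => ?_) fun _ _ => rfl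
    rw [and_assoc]
    refine and_congr_right fun hF => and_congr_right fun _ => ⟨fun h => ?_, fun h h' => ?_⟩
    · exact ((hF.2.2.2 b).resolve_right h).symm
    · exact hF.2.2.1 (h.trans h')

lemma traverseSum_sub_eq [Fintype V] [DecidableEq V] (f : Sym2 V → ℝ) (hab : G.Adj a b) :
    traverseSum G f u s a b - traverseSum G f u s b a
      = f s(a, b) * (twoForestSum G f s u a - twoForestSum G f s u b) := by
  rw [traverseSum_eq f hab, traverseSum_eq f hab.symm, twoForestSum_eq_add f b,
    twoForestSum_eq_add (a := b) f a, Sym2.eq_swap (a := b)]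
  simp only [and_comm (a := SimpleGraph.Reachable _ u b) (b := SimpleGraph.Reachable _ u a)]
  ring

lemma traverseSum_eq_zero [Fintype V] [DecidableEq V] (f : Sym2 V → ℝ) (hab : ¬ G.Adj a b) :
    traverseSum G f u s a b = 0 := by
  rw [traverseSum, Finset.filter_false_of_mem, Finset.sum_empty]
  exact fun T _ h => hab (h.1.1 h.2.mem)

lemma IsSpanningTree.traverses_iff {T : Finset (Sym2 V)} (hT : IsSpanningTree G T)
    {p : (SimpleGraph.fromEdgeSet (T : Set (Sym2 V))).Walk u s} (hp : p.IsPath) :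
    Traverses T u s a b ↔ [a, b] <:+: p.support := by
  refine ⟨fun ⟨q, hq, h⟩ => ?_, fun h => ⟨p, hp, h⟩⟩
  have := congrArg Subtype.val ((hT.2.2.subsingleton_path u s).elim ⟨p, hp⟩ ⟨q, hq⟩)
  simp only at this
  rwa [this]

/-- The net flow out of `a` along the tree paths from `u` to `s`. -/
lemma sum_traverseSum_sub [Fintype V] [DecidableEq V] (f : Sym2 V → ℝ) :
    ∑ b, (traverseSum G f u s a b - traverseSum G f u s b a)
      = ((if a = u then 1 else 0) - if a = s then 1 else 0) *
        ∑ T ∈ Finset.univ.filter (fun T : Finset (Sym2 V) => IsSpanningTree G T),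
          ∏ e ∈ T, f e := by
  have key (c d : V) : traverseSum G f u s c d
      = ∑ T ∈ Finset.univ.filter (fun T : Finset (Sym2 V) => IsSpanningTree G T),
        (if Traverses T u s c d then 1 else 0) * ∏ e ∈ T, f e := by
    rw [traverseSum, ← Finset.filter_filter, Finset.sum_filter]
    simp only [ite_mul, one_mul, zero_mul]
  simp only [key, ← Finset.sum_sub_distrib, ← sub_mul]
  rw [Finset.sum_comm, Finset.mul_sum]
  refine Finset.sum_congr rfl fun T hT => ?_
  have hT := (Finset.mem_filter.1 hT).2
  obtain ⟨p, hp⟩ := (hT.2.1.preconnected u s).exists_isPath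
  rw [← Finset.sum_mul]
  simp only [hT.traverses_iff hp]
  congr 1
  convert hp.sum_infix_sub_infix a

lemma twoForestSum_comm [Fintype V] [DecidableEq V] (f : Sym2 V → ℝ) :
    twoForestSum G f s u a = twoForestSum G f s a u := by
  have key {u a : V} {F : Finset (Sym2 V)} (hF : IsTwoForest G u s F)
      (h : (SimpleGraph.fromEdgeSet (F : Set (Sym2 V))).Reachable u a) :
      IsTwoForest G a s F ∧ (SimpleGraph.fromEdgeSet (F : Set (Sym2 V))).Reachable a u :=
    ⟨⟨hF.1, hF.2.1, fun h' => hF.2.2.1 (h.trans h'),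
      fun v => (hF.2.2.2 v).imp_left (·.trans h)⟩, h.symm⟩
  refine Finset.sum_congr (Finset.filter_congr fun F _ => ?_) fun _ _ => rfl
  exact ⟨fun h => key h.1 h.2, fun h => key h.1 h.2⟩

lemma twoForestSum_self_left [Fintype V] [DecidableEq V] (f : Sym2 V → ℝ) :
    twoForestSum G f s s a = 0 := by
  rw [twoForestSum, Finset.filter_false_of_mem, Finset.sum_empty]
  exact fun F _ h => h.1.2.2.1 (SimpleGraph.Reachable.refl _)

lemma sum_isSpanningTree_pos [Fintype V] [DecidableEq V] (hconn : G.Connected) {f : Sym2 V → ℝ}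
    (hf : ∀ e ∈ G.edgeSet, 0 < f e) :
    0 < ∑ T ∈ Finset.univ.filter (fun T : Finset (Sym2 V) => IsSpanningTree G T),
      ∏ e ∈ T, f e := by
  refine Finset.sum_pos (fun T hT => Finset.prod_pos fun e he =>
    hf e ((Finset.mem_filter.1 hT).2.1 he)) ?_
  obtain ⟨H, hle, hH⟩ := hconn.exists_isTree_le
  refine ⟨H.edgeSet.toFinset, Finset.mem_filter.2 ⟨Finset.mem_univ _, ?_⟩⟩
  unfold IsSpanningTree
  rw [Set.coe_toFinset, SimpleGraph.fromEdgeSet_edgeSet]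
  exact ⟨SimpleGraph.edgeSet_mono hle, hH.connected, hH.isAcyclic⟩

lemma sum_lap_mul [Fintype V] [DecidableEq V] (w : V → V → ℝ) (a : V) (h : V → ℝ) :
    ∑ b, lap w a b * h b = ∑ b, w a b * (h a - h b) := by
  rw [← Finset.add_sum_erase _ _ (Finset.mem_univ a), ← Finset.add_sum_erase _ (fun b =>
    w a b * (h a - h b)) (Finset.mem_univ a)]
  have h₁ : lap w a a = ∑ b ∈ Finset.univ.erase a, w a b := by
    simp [lap, Finset.filter_ne']
  have h₂ : ∑ b ∈ Finset.univ.erase a, lap w a b * h b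
      = ∑ b ∈ Finset.univ.erase a, -(w a b * h b) :=
    Finset.sum_congr rfl fun b hb => by simp [lap, (Finset.ne_of_mem_erase hb).symm]
  rw [h₁, h₂, Finset.sum_mul, ← Finset.sum_add_distrib]
  simp only [sub_self, mul_zero, zero_add]
  exact Finset.sum_congr rfl fun b _ => by ring

/-- The Green's function counts two-component forests, relative to spanning trees. -/
lemma green_mul_sum_isSpanningTree [Fintype V] [DecidableEq V] {w : V → V → ℝ}
    {f : Sym2 V → ℝ} (hf : ∀ a b, f s(a, b) = w a b) (hpos : ∀ e ∈ G.edgeSet, 0 < f e)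
    (hzero : ∀ a b, ¬ G.Adj a b → w a b = 0) (hconn : G.Connected) (s u a : V) :
    green w s u a * ∑ T ∈ Finset.univ.filter (fun T : Finset (Sym2 V) => IsSpanningTree G T),
      ∏ e ∈ T, f e = twoForestSum G f s u a := by
  set S := ∑ T ∈ Finset.univ.filter (fun T : Finset (Sym2 V) => IsSpanningTree G T),
      ∏ e ∈ T, f e with hS
  have hS0 : S ≠ 0 := (sum_isSpanningTree_pos hconn hpos).ne'
  have hflow (c d v : V) : w c d * (twoForestSum G f s v c - twoForestSum G f s v d)
      = traverseSum G f v s c d - traverseSum G f v s d c := by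
    by_cases hcd : G.Adj c d
    · rw [traverseSum_sub_eq f hcd, hf]
    · rw [hzero c d hcd, traverseSum_eq_zero f hcd, traverseSum_eq_zero f (fun h => hcd h.symm)]
      ring
  have hinv : ((lap w).submatrix (Subtype.val : {x : V // x ≠ s} → V) Subtype.val)⁻¹
      = Matrix.of fun c d : {x : V // x ≠ s} => S⁻¹ * twoForestSum G f s d c := by
    refine Matrix.inv_eq_right_inv ?_
    ext c d
    have hsum : ∑ b : {x : V // x ≠ s}, lap w c b * twoForestSum G f s d b
        = ∑ b, lap w c b * twoForestSum G f s d b := by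
      rw [← Fintype.sum_subtype_add_sum_subtype (fun b => b ≠ s)
        (fun b => lap w c b * twoForestSum G f s d b), left_eq_add]
      refine Finset.sum_eq_zero fun b _ => ?_
      rw [not_not.1 b.2, twoForestSum_comm, twoForestSum_self_left, mul_zero]
    have hmul : ∑ b, lap w c b * twoForestSum G f s d b = (if c = d then 1 else 0) * S := by
      rw [sum_lap_mul]
      simp only [hflow]
      rw [sum_traverseSum_sub, if_neg c.2, sub_zero]
      simp only [Subtype.ext_iff, hS]
    simp only [Matrix.mul_apply, Matrix.submatrix_apply, Matrix.of_apply, mul_left_comm _ S⁻¹,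
      ← Finset.mul_sum, hsum, hmul, Matrix.one_apply]
    field_simp
  unfold green
  split_ifs with hu ha
  · rw [hu, twoForestSum_self_left, zero_mul]
  · rw [ha, twoForestSum_comm, twoForestSum_self_left, zero_mul]
  · rw [hinv, Matrix.of_apply, twoForestSum_comm]
    field_simp

end

/-- For an edge `{x,y}` of `G` and vertices `u, s`:
`(Σ_{T traverses (x,y)} w(T)) − (Σ_{T traverses (y,x)} w(T))
  = w(x,y) · (G^{(s)}_{u,x} − G^{(s)}_{u,y}) · F₁(G)`. -/
theorem stmt_10 {V : Type*} [Fintype V] [DecidableEq V]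
    (hV : 1 < Fintype.card V)
    (w : V → V → ℝ) (hsym : ∀ u v, w u v = w v u)
    (hw : ∀ u v, 0 ≤ w u v) (hw0 : ∀ v, w v v = 0)
    (G : SimpleGraph V) (hG : ∀ u v, G.Adj u v ↔ u ≠ v ∧ 0 < w u v)
    (hconn : G.Connected) (u s x y : V) (hxy : G.Adj x y) :
    (∑ T ∈ Finset.univ.filter (fun T : Finset (Sym2 V) =>
        IsSpanningTree G T ∧ Traverses T u s x y),
      ∏ e ∈ T, Sym2.lift ⟨w, hsym⟩ e)
    - (∑ T ∈ Finset.univ.filter (fun T : Finset (Sym2 V) =>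
        IsSpanningTree G T ∧ Traverses T u s y x),
      ∏ e ∈ T, Sym2.lift ⟨w, hsym⟩ e)
    = w x y * (green w s u x - green w s u y) *
      ∑ T ∈ Finset.univ.filter (fun T : Finset (Sym2 V) => IsSpanningTree G T),
        ∏ e ∈ T, Sym2.lift ⟨w, hsym⟩ e := by
  have hf (a b : V) : Sym2.lift ⟨w, hsym⟩ s(a, b) = w a b := rfl
  have hpos : ∀ e ∈ G.edgeSet, 0 < Sym2.lift ⟨w, hsym⟩ e := by
    intro e
    induction e with
    | h a b => exact fun h => ((hG a b).1 h).2
  have hzero (a b : V) (hab : ¬ G.Adj a b) : w a b = 0 := by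
    rcases eq_or_ne a b with rfl | hne
    · exact hw0 a
    · exact le_antisymm (not_lt.1 fun h => hab ((hG a b).2 ⟨hne, h⟩)) (hw a b)
  rw [mul_assoc, sub_mul, green_mul_sum_isSpanningTree hf hpos hzero hconn,
    green_mul_sum_isSpanningTree hf hpos hzero hconn, ← hf x y]
  exact traverseSum_sub_eq _ hxy
end

section
/- (Merino's theorem.) Let G = (V,E) be a finite connected simple graph with at least two vertices and sink s ∈ V. Then for every real number y, Σ_{σ recurrent} y^{level(σ)} = Σ_{A ⊆ E : (V,A) is connected} (y−1)^{|A| − |V| + 1}, where the left sum is over all recurrent sandpile configurations σ and the right sum is over all edge subsets A whose spanning subgraph (V,A) is connected. (The right-hand side is the Tutte polynomial evaluation T_G(1,y).) -/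
open scoped Classical

/-- One toppling step for sandpiles on `G` with sink `s`: some unstable vertex
`v ≠ s` (with `σ(v) ≥ deg(v)`) topples, losing `deg(v)` grains and sending one grain
to each neighbor other than the sink. -/
def SandTopple {V : Type*} [Fintype V] [DecidableEq V] (G : SimpleGraph V)
    [DecidableRel G.Adj] (s : V) (σ σ' : {v : V // v ≠ s} → ℕ) : Prop :=
  ∃ v : {v : V // v ≠ s}, G.degree (v : V) ≤ σ v ∧
    σ' = fun u => if u = v then σ v - G.degree (v : V)
                  else σ u + (if G.Adj (u : V) (v : V) then 1 else 0)

/-- A sandpile configuration is stable if every non-sink vertex has fewer grains than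
its degree. -/
def SandStable {V : Type*} [Fintype V] [DecidableEq V] (G : SimpleGraph V)
    [DecidableRel G.Adj] (s : V) (σ : {v : V // v ≠ s} → ℕ) : Prop :=
  ∀ v, σ v < G.degree (v : V)

/-- A stable configuration `σ` is recurrent if from any configuration `η` one can add
some configuration `ξ` and topple finitely many times to reach `σ`. -/
def SandRecurrent {V : Type*} [Fintype V] [DecidableEq V] (G : SimpleGraph V)
    [DecidableRel G.Adj] (s : V) (σ : {v : V // v ≠ s} → ℕ) : Prop :=
  SandStable G s σ ∧
  ∀ η : {v : V // v ≠ s} → ℕ, ∃ ξ : {v : V // v ≠ s} → ℕ,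
    Relation.ReflTransGen (SandTopple G s) (η + ξ) σ

set_option linter.unusedSectionVars false

namespace Sandpile

open Finset Relation

section Sums

/-- Summing a product of local weights over the subsets of a disjoint union, where each
block carries its own local constraint, factors over the blocks. -/
lemma sum_prod_inter_eq_prod_sum {α K : Type*} [DecidableEq α] [Fintype K] [DecidableEq K]
    (E : K → Finset α) (hE : ∀ i j, i ≠ j → Disjoint (E i) (E j))
    (P : K → Finset α → Prop) (w : K → Finset α → ℝ) :
    ∑ A ∈ (univ.biUnion E).powerset.filter (fun A => ∀ k, P k (A ∩ E k)),
        ∏ k, w k (A ∩ E k)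
      = ∏ k, ∑ B ∈ (E k).powerset.filter (P k), w k B := by
  rw [Finset.prod_univ_sum]
  have key : ∀ f : K → Finset α, (∀ k, f k ⊆ E k) → ∀ k, univ.biUnion f ∩ E k = f k := by
    intro f hf k
    ext x
    simp only [mem_inter, mem_biUnion, mem_univ, true_and]
    constructor
    · rintro ⟨⟨j, hj⟩, hk⟩
      by_cases hjk : j = k
      · exact hjk ▸ hj
      · exact absurd hk (Finset.disjoint_left.1 (hE j k hjk) (hf j hj))
    · exact fun hx => ⟨⟨k, hx⟩, hf k hx⟩
  refine Finset.sum_bij' (fun A _ k => A ∩ E k) (fun f _ => univ.biUnion f) ?_ ?_ ?_ ?_ ?_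
  · intro A hA
    simp only [mem_filter, mem_powerset, Fintype.mem_piFinset] at hA ⊢
    exact fun k => ⟨inter_subset_right, hA.2 k⟩
  · intro f hf
    simp only [mem_filter, mem_powerset, Fintype.mem_piFinset] at hf ⊢
    refine ⟨Finset.biUnion_mono fun k _ => (hf k).1, fun k => ?_⟩
    rw [key f fun k => (hf k).1]
    exact (hf k).2
  · intro A hA
    simp only [mem_filter, mem_powerset] at hA
    ext x
    simp only [mem_biUnion, mem_univ, true_and, mem_inter]
    constructor
    · rintro ⟨_, h, _⟩
      exact h
    · intro hx
      obtain ⟨k, -, hk⟩ := mem_biUnion.1 (hA.1 hx)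
      exact ⟨k, hx, hk⟩
  · intro f hf
    simp only [mem_filter, mem_powerset, Fintype.mem_piFinset] at hf
    exact funext (key f fun k => (hf k).1)
  · intro A _
    rfl

lemma sum_powerset_pow_card {α : Type*} [DecidableEq α] (S : Finset α) (y : ℝ) :
    ∑ B ∈ S.powerset, (y - 1) ^ #B = y ^ #S := by
  have := Finset.sum_pow_mul_eq_add_pow (y - 1) 1 S
  simpa using this

lemma sum_nonempty_pow_card_sub_one {α : Type*} [DecidableEq α] (S : Finset α) (y : ℝ) :
    ∑ B ∈ S.powerset.filter (fun B => B.Nonempty), (y - 1) ^ (#B - 1)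
      = ∑ j ∈ range #S, y ^ j := by
  induction S using Finset.induction_on with
  | empty =>
    rw [Finset.powerset_empty, Finset.filter_singleton]
    simp
  | insert a S ha ih =>
    rw [card_insert_of_notMem ha, sum_range_succ, ← ih, ← sum_powerset_pow_card S y,
      sum_filter, sum_filter, sum_powerset_insert ha]
    congr 1
    refine sum_congr rfl fun B hB => ?_
    rw [if_pos (insert_nonempty a B),
      card_insert_of_notMem fun h => ha (mem_powerset.1 hB h), Nat.add_sub_cancel]

end Sums

variable {V : Type*} [Fintype V] [DecidableEq V] (G : SimpleGraph V) [DecidableRel G.Adj]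
  (s : V)

/-- The neighbors of `v` related to `v` by `r`. -/
noncomputable def nbrs (r : V → V → Prop) (v : V) : Finset V := (G.neighborFinset v).filter (r · v)

/-- The edges joining `v` to a neighbor related to it by `r`. -/
noncomputable def edgesTo (r : V → V → Prop) (v : V) : Finset (Sym2 V) :=
  (nbrs G r v).image (fun u => s(v, u))

/-- The edges of `G` whose endpoints have equal value under `ℓ`. -/
noncomputable def flatEdges (ℓ : V → ℕ) : Finset (Sym2 V) :=
  G.edgeFinset.filter (fun e => ∃ u v, e = s(u, v) ∧ ℓ u = ℓ v)

/-- The neighbors of `v` with level less than `m`. -/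
def nbrsBelow (ℓ : V → ℕ) (v : V) (m : ℕ) : Finset V :=
  (G.neighborFinset v).filter (ℓ · < m)

/-- `ℓ` records the time at which each vertex burns in Dhar's burning algorithm for `σ`. -/
def IsBurnLevel (σ : {v : V // v ≠ s} → ℕ) (ℓ : V → ℕ) : Prop :=
  ℓ s = 0 ∧ ∀ v : {v : V // v ≠ s},
    σ v + #(nbrsBelow G ℓ v (ℓ v - 1)) < G.degree v ∧
    G.degree v ≤ σ v + #(nbrsBelow G ℓ v (ℓ v))

/-- `A` is a set of edges of `G`, and `ℓ` records the distances to `s` in `(V, A)`. -/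
def IsDistLevel (A : Finset (Sym2 V)) (ℓ : V → ℕ) : Prop :=
  (A : Set (Sym2 V)) ⊆ G.edgeSet ∧ ℓ s = 0 ∧
    (∀ u v, s(u, v) ∈ A → ℓ v ≤ ℓ u + 1) ∧
    ∀ v, v ≠ s → ∃ u, s(v, u) ∈ A ∧ ℓ u + 1 = ℓ v

/-- `ℓ` vanishes at `s`, and each other vertex has a neighbor exactly one level below. -/
def IsLayering (ℓ : V → ℕ) : Prop :=
  ℓ s = 0 ∧ ∀ v, v ≠ s → ∃ u, G.Adj v u ∧ ℓ u + 1 = ℓ v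

variable {G s}

section Edges

variable {r : V → V → Prop} {ℓ : V → ℕ}

lemma mem_nbrs {u v : V} : u ∈ nbrs G r v ↔ G.Adj v u ∧ r u v := by
  simp [nbrs]

lemma mem_nbrsBelow {u v : V} {m : ℕ} : u ∈ nbrsBelow G ℓ v m ↔ G.Adj v u ∧ ℓ u < m := by
  simp [nbrsBelow]

lemma card_edgesTo (v : V) : #(edgesTo G r v) = #(nbrs G r v) :=
  card_image_of_injective _ fun _ _ h => Sym2.congr_right.1 h

lemma mem_edgesTo {e : Sym2 V} {v : V} :
    e ∈ edgesTo G r v ↔ ∃ u, (G.Adj v u ∧ r u v) ∧ s(v, u) = e := by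
  simp [edgesTo, mem_nbrs]

lemma mem_flatEdges {u v : V} : s(u, v) ∈ flatEdges G ℓ ↔ G.Adj u v ∧ ℓ u = ℓ v := by
  simp only [flatEdges, mem_filter, SimpleGraph.mem_edgeFinset, SimpleGraph.mem_edgeSet]
  refine and_congr_right fun _ => ⟨?_, fun h => ⟨u, v, rfl, h⟩⟩
  rintro ⟨a, b, hab, h⟩
  rcases Sym2.eq_iff.1 hab with ⟨rfl, rfl⟩ | ⟨rfl, rfl⟩
  exacts [h, h.symm]

/-- The flat edges together with the edges going down along `r` from each nonsink vertex. -/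
noncomputable def edgeBlocks (G : SimpleGraph V) [DecidableRel G.Adj] (s : V) (r : V → V → Prop)
    (ℓ : V → ℕ) : Option {v : V // v ≠ s} → Finset (Sym2 V)
  | none => flatEdges G ℓ
  | some v => edgesTo G r v

lemma disjoint_edgeBlocks (hr : ∀ u v, r u v → ℓ u < ℓ v)
    (i j : Option {v : V // v ≠ s}) (hij : i ≠ j) :
    Disjoint (edgeBlocks G s r ℓ i) (edgeBlocks G s r ℓ j) := by
  have flat : ∀ v, Disjoint (flatEdges G ℓ) (edgesTo G r v) := by
    intro v
    rw [Finset.disjoint_right]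
    intro e he hf
    obtain ⟨u, ⟨-, h⟩, rfl⟩ := mem_edgesTo.1 he
    have := (mem_flatEdges.1 hf).2
    have := hr _ _ h
    omega
  rcases i with _ | v <;> rcases j with _ | w
  · exact absurd rfl hij
  · exact flat w
  · exact (flat v).symm
  · rw [Finset.disjoint_left]
    intro e hv hw
    obtain ⟨a, ⟨-, ha⟩, rfl⟩ := mem_edgesTo.1 hv
    obtain ⟨b, ⟨-, hb⟩, h⟩ := mem_edgesTo.1 hw
    rcases Sym2.eq_iff.1 h with ⟨h, -⟩ | ⟨rfl, rfl⟩
    · exact hij (congrArg some (Subtype.ext h.symm))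
    · have := hr _ _ ha
      have := hr _ _ hb
      omega

lemma card_edgeFinset_eq (hs : ℓ s = 0) :
    #G.edgeFinset = #(flatEdges G ℓ) + ∑ v : {v : V // v ≠ s}, #(nbrsBelow G ℓ v (ℓ v)) := by
  set r : V → V → Prop := fun u v => ℓ u < ℓ v
  have h : G.edgeFinset = univ.biUnion (edgeBlocks G s r ℓ) := by
    ext e
    induction e with | _ u v
    simp only [SimpleGraph.mem_edgeFinset, SimpleGraph.mem_edgeSet, mem_biUnion, mem_univ,
      true_and]
    constructor
    · intro h
      rcases lt_trichotomy (ℓ u) (ℓ v) with huv | huv | huv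
      · refine ⟨some ⟨v, fun h => ?_⟩, mem_edgesTo.2 ⟨u, ⟨h.symm, huv⟩, Sym2.eq_swap⟩⟩
        rw [h] at huv; omega
      · exact ⟨none, mem_flatEdges.2 ⟨h, huv⟩⟩
      · refine ⟨some ⟨u, fun h => ?_⟩, mem_edgesTo.2 ⟨v, ⟨h, huv⟩, rfl⟩⟩
        rw [h] at huv; omega
    · rintro ⟨_ | w, hw⟩
      · exact (mem_flatEdges.1 hw).1
      · obtain ⟨a, ⟨h, -⟩, he⟩ := mem_edgesTo.1 hw
        rw [← SimpleGraph.mem_edgeSet, ← he]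
        exact h
  rw [h, card_biUnion fun i _ j _ => disjoint_edgeBlocks (fun _ _ h => h) i j,
    Fintype.sum_option]
  refine congrArg _ (sum_congr rfl fun v _ => (card_edgesTo _).trans ?_)
  congr 1
  ext u
  rw [mem_nbrs, mem_nbrsBelow]

end Edges

section Layering

variable {ℓ ℓ' : V → ℕ}

lemma IsLayering.exists_eq (h : IsLayering G s ℓ) (v : V) {n : ℕ} (hn : n ≤ ℓ v) :
    ∃ u, ℓ u = n := by
  induction hn using Nat.decreasingInduction with
  | self => exact ⟨v, rfl⟩
  | of_succ k hk ih =>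
    obtain ⟨u, hu⟩ := ih
    obtain ⟨w, -, hw⟩ := h.2 u (by rintro rfl; have := h.1; omega)
    exact ⟨w, by omega⟩

lemma IsLayering.lt_card (h : IsLayering G s ℓ) (v : V) : ℓ v < Fintype.card V := by
  have hsub : range (ℓ v + 1) ⊆ univ.image ℓ := by
    intro n hn
    obtain ⟨u, hu⟩ := h.exists_eq v (Nat.lt_succ_iff.1 (mem_range.1 hn))
    exact mem_image.2 ⟨u, mem_univ u, hu⟩
  have := (card_le_card hsub).trans card_image_le
  rwa [card_range, card_univ] at this

variable (G s) in
/-- The finite set of all layerings. -/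
noncomputable def layerings : Finset (V → ℕ) :=
  (Fintype.piFinset fun _ => range (Fintype.card V)).filter (IsLayering G s)

lemma mem_layerings : ℓ ∈ layerings G s ↔ IsLayering G s ℓ := by
  simp only [layerings, mem_filter, Fintype.mem_piFinset, mem_range, and_iff_right_iff_imp]
  exact fun h v => h.lt_card v

end Layering

section Dist

variable {ℓ ℓ' : V → ℕ} {A : Finset (Sym2 V)}

lemma IsDistLevel.isLayering (h : IsDistLevel G s A ℓ) : IsLayering G s ℓ :=
  ⟨h.2.1, fun v hv => let ⟨u, hu, hl⟩ := h.2.2.2 v hv; ⟨u, h.1 hu, hl⟩⟩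

lemma IsDistLevel.le (h : IsDistLevel G s A ℓ) (h' : IsDistLevel G s A ℓ') (v : V) :
    ℓ' v ≤ ℓ v := by
  induction hn : ℓ v generalizing v with
  | zero =>
    by_cases hv : v = s
    · rw [hv, h'.2.1]
    · obtain ⟨u, -, hu⟩ := h.2.2.2 v hv
      omega
  | succ n ih =>
    have hv : v ≠ s := by rintro rfl; have := h.2.1; omega
    obtain ⟨u, huA, hu⟩ := h.2.2.2 v hv
    have := ih u (by omega)
    have := h'.2.2.1 u v (Sym2.eq_swap ▸ huA)
    omega

lemma IsDistLevel.unique (h : IsDistLevel G s A ℓ) (h' : IsDistLevel G s A ℓ') : ℓ = ℓ' :=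
  funext fun v => le_antisymm (h'.le h v) (h.le h' v)

lemma IsDistLevel.connected (h : IsDistLevel G s A ℓ) :
    (SimpleGraph.fromEdgeSet (A : Set (Sym2 V))).Connected := by
  have hreach : ∀ n v, ℓ v = n →
      (SimpleGraph.fromEdgeSet (A : Set (Sym2 V))).Reachable s v := by
    intro n
    induction n with
    | zero =>
      intro v hn
      by_cases hv : v = s
      · rw [hv]
      · obtain ⟨u, -, hu⟩ := h.2.2.2 v hv
        omega
    | succ n ih =>
      intro v hn
      have hv : v ≠ s := by rintro rfl; have := h.2.1; omega
      obtain ⟨u, huA, hu⟩ := h.2.2.2 v hv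
      refine (ih u (by omega)).trans (SimpleGraph.Adj.reachable ?_)
      rw [SimpleGraph.fromEdgeSet_adj]
      refine ⟨Finset.mem_coe.2 (Sym2.eq_swap ▸ huA), ?_⟩
      rintro rfl
      omega
  have : Nonempty V := ⟨s⟩
  exact ⟨fun u v => (hreach _ u rfl).symm.trans (hreach _ v rfl)⟩

lemma exists_isDistLevel (hA : (A : Set (Sym2 V)) ⊆ G.edgeSet)
    (hc : (SimpleGraph.fromEdgeSet (A : Set (Sym2 V))).Connected) :
    ∃ ℓ, IsDistLevel G s A ℓ := by
  set H := SimpleGraph.fromEdgeSet (A : Set (Sym2 V)) with hH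
  have hadj : ∀ u v, s(u, v) ∈ A → H.Adj u v := fun u v h =>
    (SimpleGraph.fromEdgeSet_adj _).2 ⟨h, ((SimpleGraph.mem_edgeSet G).1 (hA h)).ne⟩
  refine ⟨fun v => H.dist v s, hA, SimpleGraph.dist_self, fun u v h => ?_, fun v hv => ?_⟩
  · have := hc.dist_triangle (u := v) (v := u) (w := s)
    rw [SimpleGraph.dist_eq_one_iff_adj.2 (hadj u v h).symm] at this
    simp only
    omega
  · obtain ⟨p, hp⟩ := hc.exists_walk_length_eq_dist v s
    cases p with
    | nil => exact absurd rfl hv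
    | cons hvu q =>
      rename_i u
      refine ⟨u, ((SimpleGraph.fromEdgeSet_adj _).1 hvu).1, ?_⟩
      have h1 := SimpleGraph.dist_le q
      have h2 := hc.dist_triangle (u := v) (v := u) (w := s)
      rw [SimpleGraph.dist_eq_one_iff_adj.2 hvu] at h2
      rw [SimpleGraph.Walk.length_cons] at hp
      simp only
      omega

lemma isDistLevel_iff (h : IsLayering G s ℓ) :
    IsDistLevel G s A ℓ ↔
      A ⊆ univ.biUnion (edgeBlocks G s (fun u v => ℓ u + 1 = ℓ v) ℓ) ∧
      ∀ v : {v : V // v ≠ s}, (A ∩ edgesTo G (fun u v => ℓ u + 1 = ℓ v) v).Nonempty := by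
  constructor
  · rintro ⟨hA, hs, hle, hex⟩
    refine ⟨fun e he => ?_, fun v => ?_⟩
    · induction e with | _ u v
      have hG : G.Adj u v := hA he
      have h1 := hle u v he
      have h2 := hle v u (Sym2.eq_swap ▸ he)
      rw [mem_biUnion]
      by_cases huv : ℓ u = ℓ v
      · exact ⟨none, mem_univ _, mem_flatEdges.2 ⟨hG, huv⟩⟩
      by_cases hlt : ℓ u < ℓ v
      · have hlow : ℓ u + 1 = ℓ v := by omega
        have hv : v ≠ s := by rintro rfl; omega
        exact ⟨some ⟨v, hv⟩, mem_univ _, mem_edgesTo.2 ⟨u, ⟨hG.symm, hlow⟩, Sym2.eq_swap⟩⟩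
      · have hlow : ℓ v + 1 = ℓ u := by omega
        have hu : u ≠ s := by rintro rfl; omega
        exact ⟨some ⟨u, hu⟩, mem_univ _, mem_edgesTo.2 ⟨v, ⟨hG, hlow⟩, rfl⟩⟩
    · obtain ⟨u, hu, hl⟩ := hex v v.2
      exact ⟨s(v, u), mem_inter.2 ⟨hu, mem_edgesTo.2 ⟨u, ⟨hA hu, hl⟩, rfl⟩⟩⟩
  · rintro ⟨hA, hex⟩
    have hA' : ∀ u v, s(u, v) ∈ A → G.Adj u v ∧ ℓ v ≤ ℓ u + 1 := by
      intro u v huv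
      obtain ⟨_ | w, -, hw⟩ := mem_biUnion.1 (hA huv)
      · obtain ⟨h1, h2⟩ := mem_flatEdges.1 hw
        exact ⟨h1, by omega⟩
      · obtain ⟨a, ⟨h1, h2⟩, he⟩ := mem_edgesTo.1 hw
        rcases Sym2.eq_iff.1 he with ⟨rfl, rfl⟩ | ⟨rfl, rfl⟩
        · exact ⟨h1, by omega⟩
        · exact ⟨h1.symm, by omega⟩
    refine ⟨fun e he => ?_, h.1, fun u v huv => (hA' u v huv).2, fun v hv => ?_⟩
    · induction e with | _ u v
      exact (hA' u v he).1
    · obtain ⟨e, he⟩ := hex ⟨v, hv⟩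
      obtain ⟨heA, he⟩ := mem_inter.1 he
      obtain ⟨u, ⟨-, hl⟩, rfl⟩ := mem_edgesTo.1 he
      exact ⟨u, heA, hl⟩

variable (G s) in
/-- The common contribution of a layering to both sides of Merino's theorem. -/
noncomputable def layeringWeight (ℓ : V → ℕ) (y : ℝ) : ℝ :=
  y ^ #(flatEdges G ℓ) * ∏ v : {v : V // v ≠ s},
    ∑ j ∈ range #(nbrs G (fun u v => ℓ u + 1 = ℓ v) v), y ^ j

lemma sum_isDistLevel (h : IsLayering G s ℓ) (y : ℝ) :
    ∑ A ∈ univ.filter (fun A : Finset (Sym2 V) => IsDistLevel G s A ℓ),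
      (y - 1) ^ (#A + 1 - Fintype.card V) = layeringWeight G s ℓ y := by
  set r : V → V → Prop := fun u v => ℓ u + 1 = ℓ v with hr
  set E := edgeBlocks G s r ℓ with hE
  have hdisj := disjoint_edgeBlocks (G := G) (s := s) (r := r) (ℓ := ℓ)
    (fun u v (h : ℓ u + 1 = ℓ v) => by omega)
  set P : Option {v : V // v ≠ s} → Finset (Sym2 V) → Prop :=
    fun k B => k = none ∨ B.Nonempty with hP
  set w : Option {v : V // v ≠ s} → Finset (Sym2 V) → ℝ :=
    fun k B => (y - 1) ^ (#B - if k = none then 0 else 1) with hw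
  have hprod := sum_prod_inter_eq_prod_sum E hdisj P w
  rw [Fintype.prod_option] at hprod
  have hfilter : univ.filter (fun A : Finset (Sym2 V) => IsDistLevel G s A ℓ)
      = (univ.biUnion E).powerset.filter (fun A => ∀ k, P k (A ∩ E k)) := by
    ext A
    rw [mem_filter, mem_filter, mem_powerset, isDistLevel_iff h, Option.forall]
    simp [hP, hE, edgeBlocks, hr]
  have hcardV : Fintype.card V = Fintype.card {v : V // v ≠ s} + 1 := by
    rw [Fintype.card_subtype_compl, Fintype.card_subtype_eq]
    have : 0 < Fintype.card V := Fintype.card_pos_iff.2 ⟨s⟩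
    omega
  calc _ = _ := ?_
    _ = _ := hprod
    _ = _ := ?_
  · rw [hfilter]
    refine sum_congr (by ext A; simp only [mem_filter]) fun A hA => ?_
    simp only [mem_filter, mem_powerset] at hA
    obtain ⟨hsub, hne⟩ := hA
    have hA : A = univ.biUnion fun k => A ∩ E k := by
      rw [← Finset.inter_biUnion, inter_eq_left.2 hsub]
    have hcard : #A = #(A ∩ E none) + ∑ v, #(A ∩ E (some v)) := by
      conv_lhs => rw [hA]
      rw [card_biUnion, Fintype.sum_option]
      exact fun i _ j _ hij =>
        (hdisj i j hij).mono inter_subset_right inter_subset_right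
    have hone : ∀ v, #(A ∩ E (some v)) = (#(A ∩ E (some v)) - 1) + 1 := by
      intro v
      have := (hne (some v)).resolve_left (by simp)
      have := this.card_pos
      omega
    have hsum : ∑ v, #(A ∩ E (some v))
        = ∑ v, (#(A ∩ E (some v)) - 1) + Fintype.card {v : V // v ≠ s} := by
      rw [sum_congr rfl fun v _ => hone v, sum_add_distrib]
      simp
    rw [Fintype.prod_option]
    simp only [hw, if_true, reduceCtorEq, if_false, prod_pow_eq_pow_sum, ← pow_add]
    congr 1
    omega
  · rw [layeringWeight]
    congr 1
    · simp only [hP, hw, true_or, filter_true, if_true, Nat.sub_zero]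
      exact sum_powerset_pow_card _ y
    · refine prod_congr rfl fun v _ => ?_
      simp only [hP, hw, reduceCtorEq, false_or, if_false]
      rw [← card_edgesTo, ← sum_nonempty_pow_card_sub_one]
      rfl

end Dist

section Burn

variable {ℓ ℓ' : V → ℕ} {σ : {v : V // v ≠ s} → ℕ}

lemma nbrsBelow_subset {m n : ℕ} (h : ∀ u, ℓ u < m → ℓ' u < n) (v : V) :
    nbrsBelow G ℓ v m ⊆ nbrsBelow G ℓ' v n := by
  intro u hu
  rw [mem_nbrsBelow] at hu ⊢
  exact ⟨hu.1, h u hu.2⟩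

lemma IsBurnLevel.pos (h : IsBurnLevel G s σ ℓ) (v : {v : V // v ≠ s}) : 0 < ℓ v := by
  by_contra h0
  have := h.2 v
  rw [Nat.eq_zero_of_not_pos h0, Nat.zero_sub] at this
  omega

lemma card_nbrsBelow (ℓ : V → ℕ) (v : V) (hv : 0 < ℓ v) :
    #(nbrsBelow G ℓ v (ℓ v))
      = #(nbrsBelow G ℓ v (ℓ v - 1)) + #(nbrs G (fun u v => ℓ u + 1 = ℓ v) v) := by
  rw [← card_union_of_disjoint]
  · congr 1
    ext u
    simp only [mem_union, mem_nbrsBelow, mem_nbrs, ← and_or_left]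
    refine and_congr_right fun _ => ?_
    omega
  · rw [Finset.disjoint_left]
    intro u hu hu'
    rw [mem_nbrsBelow] at hu
    rw [mem_nbrs] at hu'
    omega

lemma card_nbrsBelow_le_degree (ℓ : V → ℕ) (v : V) (m : ℕ) :
    #(nbrsBelow G ℓ v m) ≤ G.degree v :=
  card_le_card (filter_subset _ _)

lemma IsBurnLevel.isLayering (h : IsBurnLevel G s σ ℓ) : IsLayering G s ℓ := by
  refine ⟨h.1, fun v hv => ?_⟩
  have h1 := card_nbrsBelow (G := G) ℓ v (h.pos ⟨v, hv⟩)
  have h2 := h.2 ⟨v, hv⟩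
  simp only at h2
  obtain ⟨u, hu⟩ := card_pos.1 (show 0 < #(nbrs G (fun u v => ℓ u + 1 = ℓ v) v) by omega)
  exact ⟨u, mem_nbrs.1 hu⟩

lemma IsBurnLevel.le (h : IsBurnLevel G s σ ℓ) (h' : IsBurnLevel G s σ ℓ') (v : V) :
    ℓ' v ≤ ℓ v := by
  induction hn : ℓ v using Nat.strong_induction_on generalizing v with
  | _ n ih =>
    subst hn
    by_cases hv : v = s
    · rw [hv, h'.1]
      exact Nat.zero_le _
    by_contra! hlt
    have h1 := (h.2 ⟨v, hv⟩).2
    have h2 := (h'.2 ⟨v, hv⟩).1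
    have hsub : nbrsBelow G ℓ v (ℓ v) ⊆ nbrsBelow G ℓ' v (ℓ' v - 1) := by
      refine nbrsBelow_subset (fun u hu => ?_) v
      have := ih (ℓ u) hu u rfl
      omega
    have := card_le_card hsub
    simp only at h1 h2
    omega

lemma IsBurnLevel.unique (h : IsBurnLevel G s σ ℓ) (h' : IsBurnLevel G s σ ℓ') : ℓ = ℓ' :=
  funext fun v => le_antisymm (h'.le h v) (h.le h' v)

variable (G s) in
/-- The configurations whose burning levels are given by a fixed layering. -/
def burnFiber (ℓ : V → ℕ) : Finset ({v : V // v ≠ s} → ℕ) :=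
  Fintype.piFinset fun v => Ico (G.degree v - #(nbrsBelow G ℓ v (ℓ v)))
    (G.degree v - #(nbrsBelow G ℓ v (ℓ v - 1)))

lemma mem_burnFiber (h : IsLayering G s ℓ) :
    σ ∈ burnFiber G s ℓ ↔ IsBurnLevel G s σ ℓ := by
  simp only [burnFiber, Fintype.mem_piFinset, mem_Ico, IsBurnLevel, h.1, true_and]
  refine forall_congr' fun v => ?_
  omega

lemma sum_burnFiber (h : IsLayering G s ℓ) (y : ℝ) :
    ∑ σ ∈ burnFiber G s ℓ,
      y ^ ((∑ v : {v : V // v ≠ s}, (σ v : ℤ)) - #G.edgeFinset + G.degree s)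
      = layeringWeight G s ℓ y := by
  have hdeg : 2 * #G.edgeFinset = G.degree s + ∑ v : {v : V // v ≠ s}, G.degree v := by
    rw [← SimpleGraph.sum_degrees_eq_twice_card_edges, Fintype.sum_eq_add_sum_subtype_ne _ s]
  have hE := card_edgeFinset_eq (G := G) (s := s) h.1
  have hlevel : ∀ σ ∈ burnFiber G s ℓ,
      y ^ ((∑ v : {v : V // v ≠ s}, (σ v : ℤ)) - #G.edgeFinset + G.degree s)
        = y ^ #(flatEdges G ℓ) *
          ∏ v, y ^ (σ v - (G.degree v - #(nbrsBelow G ℓ v (ℓ v)))) := by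
    intro σ hσ
    rw [mem_burnFiber h] at hσ
    rw [prod_pow_eq_pow_sum, ← pow_add, ← zpow_natCast]
    congr 1
    have hterm : ∀ v : {v : V // v ≠ s},
        ((σ v - (G.degree v - #(nbrsBelow G ℓ v (ℓ v))) : ℕ) : ℤ)
          = σ v - G.degree v + #(nbrsBelow G ℓ v (ℓ v)) := by
      intro v
      have := (hσ.2 v).2
      have := card_nbrsBelow_le_degree (G := G) ℓ v (ℓ v)
      omega
    push_cast
    rw [sum_congr rfl fun v _ => hterm v, sum_add_distrib, sum_sub_distrib]
    zify at hdeg hE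
    linarith
  rw [sum_congr rfl hlevel, ← mul_sum, layeringWeight]
  congr 1
  rw [burnFiber, ← prod_univ_sum
    (f := fun (v : {v : V // v ≠ s}) i => y ^ (i - (G.degree v - #(nbrsBelow G ℓ v (ℓ v)))))]
  refine prod_congr rfl fun v _ => ?_
  have hpos : 0 < ℓ v := by
    obtain ⟨u, -, hu⟩ := h.2 v v.2
    omega
  have h1 := card_nbrsBelow (G := G) ℓ v hpos
  have h2 := card_nbrsBelow_le_degree (G := G) ℓ v (ℓ v)
  rw [sum_Ico_eq_sum_range]
  refine sum_congr (congrArg range (by omega)) fun i _ => ?_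
  rw [Nat.add_sub_cancel_left]

/-- In a configuration reached by toppling from one where every vertex is unstable, every
nonempty set of vertices contains one with at least as many grains as neighbors in the set. -/
lemma exists_card_nbrs_le_of_reflTransGen {σ τ : {v : V // v ≠ s} → ℕ}
    (hσ : ∀ v : {v : V // v ≠ s}, G.degree v ≤ σ v) (h : ReflTransGen (SandTopple G s) σ τ)
    (F : Finset V) (hF : F.Nonempty) (hs : s ∉ F) :
    ∃ v : {v : V // v ≠ s}, (v : V) ∈ F ∧ #((G.neighborFinset v).filter (· ∈ F)) ≤ τ v := by
  induction h generalizing F with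
  | refl =>
    obtain ⟨v, hv⟩ := hF
    exact ⟨⟨v, fun h => hs (h ▸ hv)⟩, hv, (card_le_card (filter_subset _ _)).trans (hσ _)⟩
  | @tail τ τ' _ hstep ih =>
    obtain ⟨w, hw, rfl⟩ := hstep
    by_cases hwF : (w : V) ∈ F
    · by_cases hne : (F.erase w).Nonempty
      · obtain ⟨v, hv, hle⟩ := ih (F.erase w) hne fun h => hs (mem_of_mem_erase h)
        have hvw : v ≠ w := fun h => (mem_erase.1 hv).1 (congrArg _ h)
        refine ⟨v, mem_of_mem_erase hv, ?_⟩
        simp only [if_neg hvw]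
        refine le_trans ?_ (Nat.add_le_add_right hle _)
        split_ifs with hadj
        · refine (card_le_card (t := insert (w : V)
            ((G.neighborFinset v).filter (· ∈ F.erase w))) fun u hu => ?_).trans
            (card_insert_le _ _)
          simp only [mem_filter, mem_insert, mem_erase] at hu ⊢
          tauto
        · refine card_le_card fun u hu => ?_
          simp only [mem_filter, mem_erase, SimpleGraph.mem_neighborFinset] at hu ⊢
          refine ⟨hu.1, ?_, hu.2⟩
          rintro rfl
          exact hadj hu.1
      · refine ⟨w, hwF, ?_⟩
        rw [card_eq_zero.2]
        · exact Nat.zero_le _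
        · refine filter_eq_empty_iff.2 fun u hu huF => hne ⟨u, mem_erase.2 ⟨?_, huF⟩⟩
          rintro rfl
          simp at hu
    · obtain ⟨v, hv, hle⟩ := ih F hF hs
      refine ⟨v, hv, ?_⟩
      have hvw : v ≠ w := fun h => hwF (h ▸ hv)
      simp only [if_neg hvw]
      exact hle.trans (Nat.le_add_right _ _)

variable (G s) in
/-- The vertices burnt after `n` rounds of Dhar's burning algorithm. -/
def burnt (σ : {v : V // v ≠ s} → ℕ) : ℕ → Finset V
  | 0 => {s}
  | n + 1 => burnt σ n ∪ (univ.filter fun v : {v : V // v ≠ s} =>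
      G.degree v ≤ σ v + #((G.neighborFinset v).filter (· ∈ burnt σ n))).map
        (Function.Embedding.subtype _)

lemma burnt_mono : Monotone (burnt G s σ) :=
  monotone_nat_of_le_succ fun _ => subset_union_left

lemma mem_burnt_succ {n : ℕ} (v : {v : V // v ≠ s}) :
    (v : V) ∈ burnt G s σ (n + 1) ↔ (v : V) ∈ burnt G s σ n ∨
      G.degree v ≤ σ v + #((G.neighborFinset v).filter (· ∈ burnt G s σ n)) := by
  simp only [burnt, mem_union, mem_map, mem_filter, mem_univ, true_and,
    Function.Embedding.subtype_apply]
  refine or_congr_right ⟨?_, fun h => ⟨v, h, rfl⟩⟩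
  rintro ⟨a, ha, hav⟩
  obtain rfl := Subtype.ext hav
  exact ha

lemma exists_isBurnLevel (hσ : SandRecurrent G s σ) : ∃ ℓ, IsBurnLevel G s σ ℓ := by
  have hall : ∀ v, ∃ n, v ∈ burnt G s σ n := by
    by_contra! hcon
    obtain ⟨ξ, hξ⟩ := hσ.2 fun v => G.degree v
    set F : Finset V := univ.filter fun v => ∀ n, v ∉ burnt G s σ n with hF
    obtain ⟨v, hv, hle⟩ := exists_card_nbrs_le_of_reflTransGen (fun v => Nat.le_add_right _ _)
      hξ F (hcon.imp fun v hv => by simpa [hF] using hv)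
      (by simp only [hF, mem_filter, mem_univ, true_and, not_forall, not_not]
          exact ⟨0, by simp [burnt]⟩)
    have hstab : ∃ N, ∀ u, u ∉ F → u ∈ burnt G s σ N := by
      have : ∀ u, ∃ n, u ∉ F → u ∈ burnt G s σ n := by
        intro u
        by_cases hu : u ∈ F
        · exact ⟨0, fun h => absurd hu h⟩
        · simp only [hF, mem_filter, mem_univ, true_and, not_forall, not_not] at hu
          exact hu.imp fun n hn _ => hn
      choose f hf using this
      exact ⟨univ.sup f, fun u hu => burnt_mono (le_sup (mem_univ u)) (hf u hu)⟩
    obtain ⟨N, hN⟩ := hstab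
    refine (mem_filter.1 hv).2 (N + 1) ((mem_burnt_succ v).2 (Or.inr ?_))
    rw [← SimpleGraph.card_neighborFinset_eq_degree,
      ← card_filter_add_card_filter_not (s := G.neighborFinset v) (· ∈ F)]
    refine Nat.add_le_add hle (card_le_card fun u hu => ?_)
    rw [mem_filter] at hu ⊢
    exact ⟨hu.1, hN u hu.2⟩
  have hlt : ∀ u n, Nat.find (hall u) < n + 1 ↔ u ∈ burnt G s σ n := fun u n =>
    ⟨fun h => burnt_mono (Nat.lt_succ_iff.1 h) (Nat.find_spec (hall u)),
      fun h => Nat.lt_succ_iff.2 (Nat.find_min' _ h)⟩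
  refine ⟨fun v => Nat.find (hall v), (Nat.find_eq_zero _).2 (by simp [burnt]), fun v => ?_⟩
  have hbelow : ∀ n, nbrsBelow G (fun v => Nat.find (hall v)) v (n + 1)
      = (G.neighborFinset v).filter (· ∈ burnt G s σ n) := by
    intro n
    ext u
    rw [mem_nbrsBelow, mem_filter, SimpleGraph.mem_neighborFinset]
    exact and_congr_right fun _ => hlt u n
  have hmin : ∀ m, m < Nat.find (hall v) → (v : V) ∉ burnt G s σ m :=
    fun m hm => Nat.find_min (hall v) hm
  have hspec := Nat.find_spec (hall v)
  simp only
  cases hn : Nat.find (hall v) with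
  | zero =>
    rw [hn] at hspec
    exact absurd (by simpa [burnt] using hspec) v.2
  | succ n =>
    rw [hn] at hspec hmin
    have hnot := hmin n (Nat.lt_succ_self n)
    refine ⟨?_, ?_⟩
    · cases n with
      | zero =>
        have : nbrsBelow G (fun v => Nat.find (hall v)) v 0 = ∅ := by
          ext u; simp [mem_nbrsBelow]
        simpa [this] using hσ.1 v
      | succ m =>
        rw [Nat.add_sub_cancel, hbelow]
        by_contra! hge
        exact hnot ((mem_burnt_succ v).2 (Or.inr hge))
    · rw [hbelow]
      exact ((mem_burnt_succ v).1 hspec).resolve_left hnot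

lemma sandTopple_add_right {σ τ : {v : V // v ≠ s} → ℕ} (h : SandTopple G s σ τ)
    (c : {v : V // v ≠ s} → ℕ) : SandTopple G s (σ + c) (τ + c) := by
  obtain ⟨v, hv, rfl⟩ := h
  refine ⟨v, hv.trans (Nat.le_add_right _ _), funext fun u => ?_⟩
  simp only [Pi.add_apply]
  split_ifs with huv
  · subst huv; omega
  · omega
  · omega

lemma reflTransGen_add_right {σ τ : {v : V // v ≠ s} → ℕ}
    (h : ReflTransGen (SandTopple G s) σ τ) (c : {v : V // v ≠ s} → ℕ) :
    ReflTransGen (SandTopple G s) (σ + c) (τ + c) :=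
  h.lift (· + c) fun _ _ h => sandTopple_add_right h c

lemma reflTransGen_add {σ τ σ' τ' : {v : V // v ≠ s} → ℕ}
    (h : ReflTransGen (SandTopple G s) σ τ) (h' : ReflTransGen (SandTopple G s) σ' τ') :
    ReflTransGen (SandTopple G s) (σ + σ') (τ + τ') := by
  refine (reflTransGen_add_right h σ').trans ?_
  rw [add_comm τ, add_comm τ]
  exact reflTransGen_add_right h' τ

lemma sandTopple_diamond {σ τ τ' : {v : V // v ≠ s} → ℕ}
    (h : SandTopple G s σ τ) (h' : SandTopple G s σ τ') :
    ∃ ρ, ReflGen (SandTopple G s) τ ρ ∧ ReflTransGen (SandTopple G s) τ' ρ := by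
  obtain ⟨v, hv, rfl⟩ := h
  obtain ⟨w, hw, rfl⟩ := h'
  by_cases hvw : v = w
  · subst hvw
    exact ⟨_, ReflGen.refl, ReflTransGen.refl⟩
  refine ⟨_, ReflGen.single ⟨w, ?_, rfl⟩, ReflTransGen.single ⟨v, ?_, ?_⟩⟩
  · simp only [if_neg (Ne.symm hvw)]
    omega
  · simp only [if_neg hvw]
    omega
  · funext u
    simp only [if_neg hvw, if_neg (Ne.symm hvw)]
    by_cases huv : u = v
    · subst huv
      simp only [if_neg hvw, if_true]
      omega
    · by_cases huw : u = w
      · subst huw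
        simp only [if_neg huv, if_true]
        omega
      · simp only [if_neg huv, if_neg huw]
        omega

lemma reflTransGen_of_stable {σ τ ρ : {v : V // v ≠ s} → ℕ} (hρ : SandStable G s ρ)
    (h : ReflTransGen (SandTopple G s) σ τ) (h' : ReflTransGen (SandTopple G s) σ ρ) :
    ReflTransGen (SandTopple G s) τ ρ := by
  obtain ⟨d, hd, hd'⟩ := church_rosser (fun _ _ _ => sandTopple_diamond) h h'
  rcases hd'.cases_head with rfl | ⟨_, ⟨v, hv, -⟩, -⟩
  · exact hd
  · exact absurd (hρ v) (not_lt.2 hv)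

variable (G s) in
/-- The configuration created by firing the sink. -/
def sinkFiring (v : {v : V // v ≠ s}) : ℕ := if G.Adj v s then 1 else 0

variable (G s) in
/-- The result of firing the vertices in `S` once each, starting from `σ`. -/
def fire (σ : {v : V // v ≠ s} → ℕ) (S : Finset V) (v : {v : V // v ≠ s}) : ℕ :=
  σ v + #((G.neighborFinset v).filter (· ∈ S)) - if (v : V) ∈ S then G.degree v else 0

lemma card_filter_mem_insert {a v : V} {S : Finset V} (ha : a ∉ S) :
    #((G.neighborFinset v).filter (· ∈ insert a S))
      = #((G.neighborFinset v).filter (· ∈ S)) + if G.Adj v a then 1 else 0 := by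
  have hins : (G.neighborFinset v).filter (· ∈ insert a S)
      = (G.neighborFinset v).filter (· ∈ S) ∪ (if G.Adj v a then {a} else ∅) := by
    ext u
    split_ifs with h <;> simp only [mem_filter, mem_insert, mem_union, mem_singleton,
      SimpleGraph.mem_neighborFinset, notMem_empty]
    · constructor
      · tauto
      · rintro (h | rfl) <;> tauto
    · constructor
      · rintro ⟨h1, rfl | h2⟩ <;> tauto
      · tauto
  rw [hins, card_union_of_disjoint]
  · split_ifs <;> simp
  · split_ifs <;> simp [ha]

lemma IsBurnLevel.reflTransGen_fire (h : IsBurnLevel G s σ ℓ) (S : Finset V)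
    (hS : ∀ v ∈ S, ∀ u, ℓ u < ℓ v → u ∈ S) (hs : s ∈ S) :
    ReflTransGen (SandTopple G s) (σ + sinkFiring G s) (fire G s σ S) := by
  induction S using Finset.induction_on_max_value ℓ with
  | empty => simp at hs
  | insert a S haS hmax ih =>
    have hdown : ∀ v ∈ S, ∀ u, ℓ u < ℓ v → u ∈ S := by
      intro v hv u hu
      refine (mem_insert.1 (hS v (mem_insert_of_mem hv) u hu)).resolve_left ?_
      rintro rfl
      exact absurd (hmax v hv) (not_le.2 hu)
    have hbelow : ∀ v : {v : V // v ≠ s}, (∀ u, ℓ u < ℓ v → u ∈ S) →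
        G.degree v ≤ σ v + #((G.neighborFinset v).filter (· ∈ S)) := by
      intro v hv
      refine (h.2 v).2.trans (Nat.add_le_add_left (card_le_card fun u hu => ?_) _)
      rw [mem_nbrsBelow] at hu
      exact mem_filter.2 ⟨(SimpleGraph.mem_neighborFinset _ _ _).2 hu.1, hv u hu.2⟩
    by_cases has : a = s
    · subst has
      have hempty : S = ∅ := by
        refine eq_empty_of_forall_notMem fun x hx => ?_
        have hxa : x ≠ a := fun hxa => haS (hxa ▸ hx)
        have h1 := h.pos ⟨x, hxa⟩
        have h2 := hmax x hx
        have h3 := h.1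
        simp only at h1
        omega
      subst hempty
      convert ReflTransGen.refl using 1
      funext v
      rw [fire, card_filter_mem_insert haS]
      simp [sinkFiring, v.2]
    · have hsS : s ∈ S := (mem_insert.1 hs).resolve_left (Ne.symm has)
      refine (ih hdown hsS).tail ⟨⟨a, has⟩, ?_, ?_⟩
      · simp only [fire, if_neg haS, Nat.sub_zero]
        refine hbelow ⟨a, has⟩ fun u hu => ?_
        refine (mem_insert.1 (hS a (mem_insert_self a S) u hu)).resolve_left ?_
        rintro rfl
        exact lt_irrefl _ hu
      · funext v
        by_cases hva : v = ⟨a, has⟩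
        · subst hva
          rw [fire, card_filter_mem_insert haS]
          simp [fire, haS]
        · have hva' : (v : V) ≠ a := fun h => hva (Subtype.ext h)
          rw [if_neg hva, fire, fire, card_filter_mem_insert haS]
          simp only [mem_insert, hva', false_or]
          by_cases hvS : (v : V) ∈ S
          · have := hbelow v (hdown v hvS)
            simp only [if_pos hvS]
            omega
          · simp only [if_neg hvS, Nat.sub_zero, add_assoc]

lemma IsBurnLevel.reflTransGen_add_sinkFiring (h : IsBurnLevel G s σ ℓ) (m : ℕ) :
    ReflTransGen (SandTopple G s) (σ + m • sinkFiring G s) σ := by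
  have hone : ReflTransGen (SandTopple G s) (σ + sinkFiring G s) σ := by
    convert h.reflTransGen_fire univ (fun _ _ _ _ => mem_univ _) (mem_univ s) using 1
    funext v
    simp [fire]
  induction m with
  | zero => simpa using ReflTransGen.refl
  | succ m ih =>
    rw [succ_nsmul, ← add_assoc, add_right_comm]
    exact (reflTransGen_add_right hone _).trans ih

lemma reflTransGen_nsmul {σ τ : {v : V // v ≠ s} → ℕ}
    (h : ReflTransGen (SandTopple G s) σ τ) (n : ℕ) :
    ReflTransGen (SandTopple G s) (n • σ) (n • τ) := by
  induction n with
  | zero => simpa using ReflTransGen.refl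
  | succ n ih =>
    rw [succ_nsmul, succ_nsmul]
    exact reflTransGen_add ih h

lemma IsLayering.exists_reflTransGen_pos (h : IsLayering G s ℓ) (v : V) (hv : v ≠ s) :
    ∃ (m : ℕ) (c : _), ReflTransGen (SandTopple G s) (m • sinkFiring G s) c ∧ 0 < c ⟨v, hv⟩ := by
  induction hn : ℓ v generalizing v with
  | zero =>
    obtain ⟨u, -, hu⟩ := h.2 v hv
    omega
  | succ n ih =>
    obtain ⟨u, hadj, hu⟩ := h.2 v hv
    by_cases hus : u = s
    · subst hus
      exact ⟨1, _, ReflTransGen.refl, by simp [sinkFiring, hadj]⟩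
    · obtain ⟨m, c, hc, hpos⟩ := ih u hus (by omega)
      have hreach := reflTransGen_nsmul hc (G.degree u)
      rw [← mul_nsmul'] at hreach
      refine ⟨_, _, hreach.tail ⟨⟨u, hus⟩, ?_, rfl⟩, ?_⟩
      · exact Nat.le_mul_of_pos_right _ hpos
      · have hvu : (⟨v, hv⟩ : {v : V // v ≠ s}) ≠ ⟨u, hus⟩ :=
          fun h => hadj.ne (congrArg Subtype.val h)
        simp [hvu, hadj]

lemma IsLayering.exists_reflTransGen_ge (h : IsLayering G s ℓ) (η : {v : V // v ≠ s} → ℕ) :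
    ∃ (m : ℕ) (c : _), ReflTransGen (SandTopple G s) (m • sinkFiring G s) c ∧ η ≤ c := by
  choose m c hc hpos using fun v : {v : V // v ≠ s} => h.exists_reflTransGen_pos v v.2
  have hsum : ∀ T : Finset {v : V // v ≠ s}, ∃ (M : ℕ) (C : _),
      ReflTransGen (SandTopple G s) (M • sinkFiring G s) C ∧ ∀ v ∈ T, η v ≤ C v := by
    intro T
    induction T using Finset.induction_on with
    | empty => exact ⟨0, _, ReflTransGen.refl, by simp⟩
    | insert a T _ ih =>
      obtain ⟨M, C, hC, hle⟩ := ih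
      have hreach := reflTransGen_add (reflTransGen_nsmul (hc a) (η a)) hC
      rw [← mul_nsmul', ← add_nsmul] at hreach
      refine ⟨_, _, hreach, fun v hv => ?_⟩
      rcases mem_insert.1 hv with rfl | hv
      · exact (Nat.le_mul_of_pos_right _ (hpos v)).trans (Nat.le_add_right _ _)
      · exact (hle v hv).trans (Nat.le_add_left _ _)
  obtain ⟨M, C, hC, hle⟩ := hsum univ
  exact ⟨M, C, hC, fun v => hle v (mem_univ v)⟩

lemma IsBurnLevel.sandRecurrent (h : IsBurnLevel G s σ ℓ) : SandRecurrent G s σ := by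
  have hstable : SandStable G s σ := fun v => by
    have := (h.2 v).1
    omega
  refine ⟨hstable, fun η => ?_⟩
  obtain ⟨m, c, hc, hle⟩ := h.isLayering.exists_reflTransGen_ge η
  refine ⟨(c - η) + σ, ?_⟩
  rw [← add_assoc, add_tsub_cancel_of_le hle, add_comm]
  refine reflTransGen_of_stable hstable ?_ (h.reflTransGen_add_sinkFiring m)
  exact reflTransGen_add ReflTransGen.refl hc

lemma sandRecurrent_iff : SandRecurrent G s σ ↔ ∃ ℓ, IsBurnLevel G s σ ℓ :=
  ⟨exists_isBurnLevel, fun ⟨_, h⟩ => h.sandRecurrent⟩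

end Burn

end Sandpile

/-- **Merino's theorem.**  For a finite connected simple graph with at least two
vertices and sink `s`, and any real `y`,
`Σ_{σ recurrent} y^{level(σ)} = Σ_{A ⊆ E, (V,A) connected} (y−1)^{|A|−|V|+1}`,
where `level(σ) = Σ_v σ(v) − |E| + deg(s)`. -/
theorem stmt_13 {V : Type*} [Fintype V] [DecidableEq V] (G : SimpleGraph V)
    [DecidableRel G.Adj] (s : V)
    (hV : 1 < Fintype.card V) (hconn : G.Connected) (y : ℝ) :
    ∑ᶠ σ ∈ {σ : {v : V // v ≠ s} → ℕ | SandRecurrent G s σ},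
        y ^ ((∑ v : {v : V // v ≠ s}, (σ v : ℤ)) - G.edgeFinset.card + G.degree s)
    = ∑ A ∈ Finset.univ.filter (fun A : Finset (Sym2 V) =>
        (A : Set (Sym2 V)) ⊆ G.edgeSet ∧
        (SimpleGraph.fromEdgeSet (A : Set (Sym2 V))).Connected),
        (y - 1) ^ (A.card + 1 - Fintype.card V) := by
  have hrec : {σ : {v : V // v ≠ s} → ℕ | SandRecurrent G s σ}
      = ((Sandpile.layerings G s).biUnion (Sandpile.burnFiber G s) :
        Finset ({v : V // v ≠ s} → ℕ)) := by
    ext σ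
    simp only [Set.mem_ofPred_eq, Finset.mem_coe, Finset.mem_biUnion, Sandpile.mem_layerings,
      Sandpile.sandRecurrent_iff]
    exact ⟨fun ⟨ℓ, h⟩ => ⟨ℓ, h.isLayering, (Sandpile.mem_burnFiber h.isLayering).2 h⟩,
      fun ⟨ℓ, hℓ, h⟩ => ⟨ℓ, (Sandpile.mem_burnFiber hℓ).1 h⟩⟩
  have hconnected : Finset.univ.filter (fun A : Finset (Sym2 V) =>
        (A : Set (Sym2 V)) ⊆ G.edgeSet ∧
        (SimpleGraph.fromEdgeSet (A : Set (Sym2 V))).Connected)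
      = (Sandpile.layerings G s).biUnion fun ℓ =>
        Finset.univ.filter fun A : Finset (Sym2 V) => Sandpile.IsDistLevel G s A ℓ := by
    ext A
    simp only [Finset.mem_filter, Finset.mem_univ, true_and, Finset.mem_biUnion,
      Sandpile.mem_layerings]
    constructor
    · rintro ⟨hA, hc⟩
      obtain ⟨ℓ, h⟩ := Sandpile.exists_isDistLevel (s := s) hA hc
      exact ⟨ℓ, h.isLayering, h⟩
    · rintro ⟨ℓ, -, h⟩
      exact ⟨h.1, h.connected⟩
  rw [hrec, finsum_mem_coe_finset, hconnected, Finset.sum_biUnion, Finset.sum_biUnion]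
  · refine Finset.sum_congr rfl fun ℓ hℓ => ?_
    rw [Sandpile.mem_layerings] at hℓ
    rw [Sandpile.sum_burnFiber hℓ, Sandpile.sum_isDistLevel hℓ]
  · intro ℓ _ ℓ' _ hne
    refine Finset.disjoint_left.2 fun A hA hA' => hne ?_
    exact (Finset.mem_filter.1 hA).2.unique (Finset.mem_filter.1 hA').2
  · intro ℓ hℓ ℓ' hℓ' hne
    rw [Finset.mem_coe, Sandpile.mem_layerings] at hℓ hℓ'
    refine Finset.disjoint_left.2 fun σ hσ hσ' => hne ?_
    exact ((Sandpile.mem_burnFiber hℓ).1 hσ).unique ((Sandpile.mem_burnFiber hℓ').1 hσ')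
end

section
/- Let G = (V,E) be a finite connected simple graph with at least two vertices and sink s ∈ V, and let j ≥ 0 be an integer. Then Σ_{σ recurrent} C(level(σ), j) equals the number of subsets A ⊆ E with |A| = |V| − 1 + j such that the spanning subgraph (V,A) is connected, where C(n,j) denotes the binomial coefficient and the sum is over all recurrent sandpile configurations σ. In particular (j = 0) the number of recurrent configurations equals the number of spanning trees of G, and (j = 1) Σ_{σ recurrent} level(σ) equals the number of spanning unicycles of G. -/
open scoped Classical

/-- The neighbours of `v` outside `F` along edges of `E`. -/
def outNeighbors {V : Type*} [Fintype V] [DecidableEq V] (E : Finset (Sym2 V)) (F : Finset V) (v : V) :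
    Finset V :=
  Finset.univ.filter (fun u => u ∉ F ∧ s(v, u) ∈ E)

/-- Every vertex is joined to `B` by edges of `A`, phrased in terms of cuts. -/
def ReachesFrom {V : Type*} [Fintype V] [DecidableEq V] (B : Finset V) (A : Finset (Sym2 V)) : Prop :=
  ∀ F : Finset V, Disjoint F B → F.Nonempty → ∃ v ∈ F, (outNeighbors A F v).Nonempty

/-- Parking functions (shifted to be positive off `B`) of the edge set `E`, with `B`
contracted to a single root. -/
def parkingFunctions {V : Type*} [Fintype V] [DecidableEq V] (B : Finset V) (E : Finset (Sym2 V)) :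
    Set (V → ℕ) :=
  {k | (∀ u, k u = 0 ↔ u ∈ B) ∧
    ∀ F : Finset V, Disjoint F B → F.Nonempty → ∃ v ∈ F, k v ≤ (outNeighbors E F v).card}

section Counting

variable {V : Type*} [Fintype V] [DecidableEq V]

lemma mem_outNeighbors {E : Finset (Sym2 V)} {F : Finset V} {v u : V} :
    u ∈ outNeighbors E F v ↔ u ∉ F ∧ s(v, u) ∈ E := by
  simp [outNeighbors]

lemma outNeighbors_erase_of_ne {E : Finset (Sym2 V)} {F : Finset V} {b v x : V}
    (hb : x ≠ b) (hv : x ≠ v) :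
    outNeighbors (E.erase s(b, v)) F x = outNeighbors E F x := by
  ext u
  simp only [mem_outNeighbors, Finset.mem_erase, ne_eq, Sym2.eq_iff]
  grind

lemma card_outNeighbors_erase {E : Finset (Sym2 V)} {F : Finset V} {b v : V}
    (he : s(b, v) ∈ E) (hb : b ∉ F) :
    (outNeighbors E F v).card = (outNeighbors (E.erase s(b, v)) F v).card + 1 := by
  have h : outNeighbors (E.erase s(b, v)) F v = (outNeighbors E F v).erase b := by
    ext u
    simp only [mem_outNeighbors, Finset.mem_erase, ne_eq, Sym2.eq_iff]
    grind
  have hmem : b ∈ outNeighbors E F v := mem_outNeighbors.2 ⟨hb, by rwa [Sym2.eq_swap]⟩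
  rw [h, Finset.card_erase_add_one hmem]

lemma parkingFunctions_finite (B : Finset V) (E : Finset (Sym2 V)) :
    (parkingFunctions B E).Finite := by
  refine (Set.finite_Iic (fun _ : V => Fintype.card V)).subset ?_
  rintro k ⟨hk, hF⟩ v
  by_cases hv : v ∈ B
  · simp [(hk v).2 hv]
  · obtain ⟨w, hw, hle⟩ := hF {v} (by simpa using hv) (Finset.singleton_nonempty v)
    obtain rfl := Finset.mem_singleton.1 hw
    exact hle.trans (Finset.card_le_univ _)

lemma reachesFrom_insert_iff {B : Finset V} {A : Finset (Sym2 V)} {b v : V}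
    (he : s(b, v) ∈ A) (hb : b ∈ B) :
    ReachesFrom B A ↔ ReachesFrom (insert v B) (A.erase s(b, v)) := by
  constructor
  · intro h F hF hne
    rw [Finset.disjoint_insert_right] at hF
    obtain ⟨x, hx, hxn⟩ := h F hF.2 hne
    refine ⟨x, hx, ?_⟩
    rwa [outNeighbors_erase_of_ne]
    · rintro rfl; exact Finset.disjoint_left.1 hF.2 hx hb
    · rintro rfl; exact hF.1 hx
  · intro h F hF hne
    have hbF : b ∉ F := fun hbF => Finset.disjoint_left.1 hF hbF hb
    by_cases hv : v ∈ F
    · exact ⟨v, hv, b, mem_outNeighbors.2 ⟨hbF, by rwa [Sym2.eq_swap]⟩⟩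
    · obtain ⟨x, hx, hxn⟩ := h F (Finset.disjoint_insert_right.2 ⟨hv, hF⟩) hne
      refine ⟨x, hx, ?_⟩
      rwa [outNeighbors_erase_of_ne] at hxn
      · rintro rfl; exact hbF hx
      · rintro rfl; exact hv hx

lemma add_single_mem_parkingFunctions {B : Finset V} {E : Finset (Sym2 V)} {b v : V}
    (he : s(b, v) ∈ E) (hb : b ∈ B) (hv : v ∉ B) (k : V → ℕ) :
    k + Pi.single v 1 ∈ parkingFunctions B E ↔
      k ∈ parkingFunctions (insert v B) (E.erase s(b, v)) ∪
        parkingFunctions B (E.erase s(b, v)) := by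
  have hne : ∀ u, u ≠ v → (k + Pi.single v 1 : V → ℕ) u = k u := by
    intro u hu; simp [hu]
  have hself : (k + Pi.single v 1 : V → ℕ) v = k v + 1 := by simp
  constructor
  · rintro ⟨hk, hF⟩
    by_cases h0 : k v = 0
    · refine Or.inl ⟨fun u => ?_, fun F hd hn => ?_⟩
      · by_cases hu : u = v
        · subst hu; simp [h0]
        · rw [← hne u hu, hk u]; simp [hu]
      · rw [Finset.disjoint_insert_right] at hd
        obtain ⟨x, hx, hle⟩ := hF F hd.2 hn
        have hxv : x ≠ v := by rintro rfl; exact hd.1 hx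
        refine ⟨x, hx, ?_⟩
        rw [outNeighbors_erase_of_ne _ hxv, ← hne x hxv]
        · exact hle
        · rintro rfl; exact Finset.disjoint_left.1 hd.2 hx hb
    · refine Or.inr ⟨fun u => ?_, fun F hd hn => ?_⟩
      · by_cases hu : u = v
        · subst hu; simp [h0, hv]
        · rw [← hne u hu, hk u]
      · obtain ⟨x, hx, hle⟩ := hF F hd hn
        have hbF : b ∉ F := fun hbF => Finset.disjoint_left.1 hd hbF hb
        refine ⟨x, hx, ?_⟩
        by_cases hxv : x = v
        · subst hxv
          rw [hself, card_outNeighbors_erase he hbF] at hle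
          omega
        · rw [outNeighbors_erase_of_ne _ hxv, ← hne x hxv]
          · exact hle
          · rintro rfl; exact hbF hx
  · rintro (⟨hk, hF⟩ | ⟨hk, hF⟩)
    · refine ⟨fun u => ?_, fun F hd hn => ?_⟩
      · by_cases hu : u = v
        · subst hu; simp [hv]
        · rw [hne u hu, hk u]; simp [hu]
      · have hbF : b ∉ F := fun hbF => Finset.disjoint_left.1 hd hbF hb
        by_cases hvF : v ∈ F
        · refine ⟨v, hvF, ?_⟩
          rw [hself, card_outNeighbors_erase he hbF, (hk v).2 (Finset.mem_insert_self _ _)]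
          omega
        · obtain ⟨x, hx, hle⟩ := hF F (Finset.disjoint_insert_right.2 ⟨hvF, hd⟩) hn
          have hxv : x ≠ v := by rintro rfl; exact hvF hx
          refine ⟨x, hx, ?_⟩
          rw [outNeighbors_erase_of_ne _ hxv] at hle
          · rwa [hne x hxv]
          · rintro rfl; exact hbF hx
    · refine ⟨fun u => ?_, fun F hd hn => ?_⟩
      · by_cases hu : u = v
        · subst hu; simp [hv]
        · rw [hne u hu, hk u]
      · have hbF : b ∉ F := fun hbF => Finset.disjoint_left.1 hd hbF hb
        obtain ⟨x, hx, hle⟩ := hF F hd hn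
        refine ⟨x, hx, ?_⟩
        by_cases hxv : x = v
        · subst hxv
          rw [hself, card_outNeighbors_erase he hbF]
          omega
        · rw [outNeighbors_erase_of_ne _ hxv] at hle
          · rwa [hne x hxv]
          · rintro rfl; exact hbF hx

lemma parkingFunctions_eq_image {B : Finset V} {E : Finset (Sym2 V)} {b v : V}
    (he : s(b, v) ∈ E) (hb : b ∈ B) (hv : v ∉ B) :
    parkingFunctions B E = (fun k => k + Pi.single v 1) ''
      (parkingFunctions (insert v B) (E.erase s(b, v)) ∪
        parkingFunctions B (E.erase s(b, v))) := by
  ext k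
  constructor
  · intro hk
    have hpos : k v ≠ 0 := fun h => hv ((hk.1 v).1 h)
    have hadd : k - Pi.single v 1 + Pi.single v 1 = k := by
      ext u
      by_cases hu : u = v
      · subst hu; simp; omega
      · simp [hu]
    refine ⟨k - Pi.single v 1, ?_, hadd⟩
    rwa [← add_single_mem_parkingFunctions he hb hv, hadd]
  · rintro ⟨k, hk, rfl⟩
    exact (add_single_mem_parkingFunctions he hb hv k).2 hk

lemma finsum_parkingFunctions_erase {B : Finset V} {E : Finset (Sym2 V)} {b v : V}
    (he : s(b, v) ∈ E) (hb : b ∈ B) (hv : v ∉ B) (j : ℕ) :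
    ∑ᶠ k ∈ parkingFunctions B E, (E.card - ∑ u, k u).choose j =
      (∑ᶠ k ∈ parkingFunctions (insert v B) (E.erase s(b, v)),
        ((E.erase s(b, v)).card - ∑ u, k u).choose j) +
      ∑ᶠ k ∈ parkingFunctions B (E.erase s(b, v)),
        ((E.erase s(b, v)).card - ∑ u, k u).choose j := by
  rw [parkingFunctions_eq_image he hb hv,
    finsum_mem_image (add_left_injective _).injOn, ← finsum_mem_union]
  · refine finsum_mem_congr rfl fun k _ => ?_
    have h1 : ∑ u, (k + Pi.single v 1 : V → ℕ) u = ∑ u, k u + 1 := by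
      simp [Finset.sum_add_distrib]
    rw [h1, ← Finset.card_erase_add_one he, Nat.add_sub_add_right]
  · rw [Set.disjoint_left]
    intro k h1 h2
    exact hv ((h2.1 v).1 ((h1.1 v).2 (Finset.mem_insert_self _ _)))
  · exact parkingFunctions_finite _ _
  · exact parkingFunctions_finite _ _

lemma card_reachesFrom_erase {B : Finset V} {E : Finset (Sym2 V)} {b v : V}
    (he : s(b, v) ∈ E) (hb : b ∈ B) (hv : v ∉ B) (j : ℕ) :
    (E.powerset.filter fun A => ReachesFrom B A ∧ A.card = Bᶜ.card + j).card =
      ((E.erase s(b, v)).powerset.filter fun A =>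
        ReachesFrom (insert v B) A ∧ A.card = (insert v B)ᶜ.card + j).card +
      ((E.erase s(b, v)).powerset.filter fun A =>
        ReachesFrom B A ∧ A.card = Bᶜ.card + j).card := by
  have hcard : Bᶜ.card = (insert v B)ᶜ.card + 1 := by
    rw [Finset.compl_insert, Finset.card_erase_add_one (by simpa using hv)]
  rw [← Finset.card_filter_add_card_filter_not (fun A => s(b, v) ∈ A)]
  congr 1
  · refine Finset.card_bij' (fun A _ => A.erase s(b, v)) (fun A _ => insert s(b, v) A)
      ?_ ?_ ?_ ?_
    · intro A hA
      simp only [Finset.mem_filter, Finset.mem_powerset] at hA ⊢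
      obtain ⟨⟨hAE, hr, hc⟩, heA⟩ := hA
      refine ⟨Finset.erase_subset_erase _ hAE, (reachesFrom_insert_iff heA hb).1 hr, ?_⟩
      rw [Finset.card_erase_of_mem heA]
      omega
    · intro A hA
      simp only [Finset.mem_filter, Finset.mem_powerset] at hA ⊢
      obtain ⟨hAE, hr, hc⟩ := hA
      have heA : s(b, v) ∉ A := fun h => Finset.notMem_erase _ _ (hAE h)
      have hmem := Finset.mem_insert_self s(b, v) A
      refine ⟨⟨?_, ?_, ?_⟩, hmem⟩
      · exact Finset.insert_subset he (hAE.trans (Finset.erase_subset _ _))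
      · rw [reachesFrom_insert_iff hmem hb, Finset.erase_insert heA]
        exact hr
      · rw [Finset.card_insert_of_notMem heA]
        omega
    · intro A hA
      simp only [Finset.mem_filter] at hA
      exact Finset.insert_erase hA.2
    · intro A hA
      simp only [Finset.mem_filter, Finset.mem_powerset] at hA
      exact Finset.erase_insert fun h => Finset.notMem_erase _ _ (hA.1 h)
  · congr 1
    ext A
    simp only [Finset.mem_filter, Finset.mem_powerset, Finset.subset_erase]
    tauto

/-- Merino's identity for a graph with the vertices of `B` contracted to a root. -/
theorem finsum_parkingFunctions_choose (j : ℕ) (E : Finset (Sym2 V)) (B : Finset V) :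
    ∑ᶠ k ∈ parkingFunctions B E, (E.card - ∑ u, k u).choose j =
      (E.powerset.filter fun A => ReachesFrom B A ∧ A.card = Bᶜ.card + j).card := by
  induction hn : E.card using Nat.strong_induction_on generalizing E B with
  | _ n ih =>
  subst hn
  by_cases hex : ∃ b ∈ B, ∃ v ∉ B, s(b, v) ∈ E
  · obtain ⟨b, hb, v, hv, he⟩ := hex
    have hlt := Finset.card_erase_lt_of_mem he
    rw [finsum_parkingFunctions_erase he hb hv, card_reachesFrom_erase he hb hv,
      ih _ hlt _ _ rfl, ih _ hlt _ _ rfl]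
  · push Not at hex
    have hempty : ∀ A ⊆ E, ∀ v ∈ Bᶜ, outNeighbors A Bᶜ v = ∅ := by
      intro A hA v hv
      ext u
      simp only [mem_outNeighbors, Finset.notMem_empty, iff_false, not_and]
      intro hu hE
      rw [Sym2.eq_swap] at hE
      exact hex u (by simpa using hu) v (by simpa using hv) (hA hE)
    rcases Bᶜ.eq_empty_or_nonempty with hB | hB
    · have hB' : B = Finset.univ := by simpa using hB
      subst hB'
      have hF : ∀ F : Finset V, Disjoint F Finset.univ → ¬ F.Nonempty := by
        intro F hd hn
        obtain ⟨x, hx⟩ := hn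
        exact Finset.disjoint_left.1 hd hx (Finset.mem_univ x)
      have hp : parkingFunctions Finset.univ E = {(0 : V → ℕ)} := by
        ext k
        constructor
        · intro hk
          exact funext fun u => (hk.1 u).2 (Finset.mem_univ u)
        · rintro rfl
          exact ⟨by simp, fun F hd hn => (hF F hd hn).elim⟩
      have hr : ∀ A : Finset (Sym2 V), ReachesFrom Finset.univ A :=
        fun A F hd hn => (hF F hd hn).elim
      rw [hp, finsum_mem_singleton]
      simp [hr, ← Finset.powersetCard_eq_filter]
    · have hdisj : Disjoint Bᶜ B := disjoint_compl_left
      have hp : parkingFunctions B E = ∅ := by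
        rw [Set.eq_empty_iff_forall_notMem]
        intro k hk
        obtain ⟨v, hv, hle⟩ := hk.2 _ hdisj hB
        rw [hempty E subset_rfl v hv, Finset.card_empty, Nat.le_zero, hk.1] at hle
        exact Finset.mem_compl.1 hv hle
      rw [hp, finsum_mem_empty, eq_comm, Finset.card_eq_zero, Finset.filter_eq_empty_iff]
      rintro A hA ⟨hr, -⟩
      obtain ⟨v, hv, hne⟩ := hr _ hdisj hB
      rw [hempty A (Finset.mem_powerset.1 hA) v hv] at hne
      exact Finset.not_nonempty_empty hne

end Counting

lemma connected_fromEdgeSet_iff {V : Type*} [Fintype V] [DecidableEq V]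
    (A : Finset (Sym2 V)) (s : V) :
    (SimpleGraph.fromEdgeSet (A : Set (Sym2 V))).Connected ↔ ReachesFrom {s} A := by
  constructor
  · intro h F hd hn
    obtain ⟨x, hx⟩ := hn
    obtain ⟨p⟩ := h.preconnected x s
    obtain ⟨d, -, h1, h2⟩ := p.exists_boundary_dart (F : Set V) hx
      (by simpa using hd)
    have hadj := (SimpleGraph.fromEdgeSet_adj _).1 d.adj
    exact ⟨d.fst, h1, d.snd, mem_outNeighbors.2 ⟨h2, hadj.1⟩⟩
  · intro h
    have hreach : ∀ v, (SimpleGraph.fromEdgeSet (A : Set (Sym2 V))).Reachable s v := by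
      by_contra! hcon
      obtain ⟨x, hx⟩ := hcon
      obtain ⟨v, hv, u, hu⟩ := h
        (Finset.univ.filter fun v =>
          ¬ (SimpleGraph.fromEdgeSet (A : Set (Sym2 V))).Reachable s v)
        (by simp) ⟨x, by simpa using hx⟩
      rw [mem_outNeighbors] at hu
      simp only [Finset.mem_filter, Finset.mem_univ, true_and, not_not] at hv hu
      have hne : u ≠ v := by rintro rfl; exact hv hu.1
      refine hv (hu.1.trans (SimpleGraph.Adj.reachable ?_))
      rw [SimpleGraph.fromEdgeSet_adj, Sym2.eq_swap]
      exact ⟨hu.2, hne⟩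
    exact (SimpleGraph.connected_iff_exists_forall_reachable _).2 ⟨s, hreach⟩

/-- On a connected graph some script strictly lowers every non-sink vertex. -/
lemma exists_superharmonic_script {V : Type*} [Fintype V] {G : SimpleGraph V}
    [DecidableRel G.Adj] {s : V} (hconn : G.Connected) :
    ∃ f : V → ℕ, f s = 0 ∧
      ∀ v, v ≠ s → ∑ u ∈ G.neighborFinset v, f u + 1 ≤ G.degree v * f v := by
  set M := Fintype.card V
  set n := ∑ u, G.dist u s
  have hM : 0 < M := Fintype.card_pos_iff.2 ⟨s⟩
  have hn : ∀ u, G.dist u s ≤ n := fun u =>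
    Finset.single_le_sum (f := fun u => G.dist u s) (fun _ _ => Nat.zero_le _)
      (Finset.mem_univ u)
  have hpow : ∀ u, M ^ (n - G.dist u s) ≤ M ^ n := fun u =>
    Nat.pow_le_pow_right hM (Nat.sub_le _ _)
  refine ⟨fun u => M ^ n - M ^ (n - G.dist u s), by simp, fun v hv => ?_⟩
  obtain ⟨w, hadj, hdist⟩ : ∃ w, G.Adj v w ∧ G.dist w s + 1 ≤ G.dist v s := by
    obtain ⟨p, hp⟩ := hconn.exists_walk_length_eq_dist v s
    cases p with
    | nil => exact absurd rfl hv
    | cons hadj q =>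
      refine ⟨_, hadj, ?_⟩
      rw [← hp, SimpleGraph.Walk.length_cons]
      exact Nat.add_le_add_right (SimpleGraph.dist_le q) 1
  have hw : M ^ (n - G.dist v s) * M ≤ M ^ (n - G.dist w s) := by
    rw [← pow_succ]
    have := hn v
    exact Nat.pow_le_pow_right hM (by omega)
  have hsum : M ^ (n - G.dist w s) ≤ ∑ u ∈ G.neighborFinset v, M ^ (n - G.dist u s) :=
    Finset.single_le_sum (f := fun u => M ^ (n - G.dist u s)) (fun _ _ => Nat.zero_le _)
      (by simpa using hadj)
  have hdeg : M ^ (n - G.dist v s) * (G.degree v + 1) ≤ M ^ (n - G.dist v s) * M :=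
    Nat.mul_le_mul_left _ (G.degree_lt_card_verts v)
  have hpos : 0 < M ^ (n - G.dist v s) := pow_pos hM _
  have htotal : ∑ u ∈ G.neighborFinset v, (M ^ n - M ^ (n - G.dist u s)) +
      ∑ u ∈ G.neighborFinset v, M ^ (n - G.dist u s) = G.degree v * M ^ n := by
    rw [← Finset.sum_add_distrib,
      Finset.sum_congr rfl fun u _ => Nat.sub_add_cancel (hpow u)]
    simp
  have hv' : G.degree v * (M ^ n - M ^ (n - G.dist v s)) +
      G.degree v * M ^ (n - G.dist v s) = G.degree v * M ^ n := by
    rw [← mul_add, Nat.sub_add_cancel (hpow v)]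
  rw [mul_add, mul_comm _ (G.degree v)] at hdeg
  simp only
  omega

section Sandpile

variable {V : Type*} [Fintype V] [DecidableEq V] (G : SimpleGraph V) [DecidableRel G.Adj]
  (s : V)

/-- Dhar's criterion: no nonempty set of non-sink vertices is a forbidden
subconfiguration of `σ`. -/
def NoForbidden (σ : {v : V // v ≠ s} → ℕ) : Prop :=
  ∀ F : Finset V, s ∉ F → F.Nonempty →
    ∃ v : {v : V // v ≠ s}, (v : V) ∈ F ∧ (F.filter (G.Adj v)).card ≤ σ v

variable {G s}

/-- The set `T` of vertices toppled along a toppling sequence contains no forbidden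
subconfiguration of the final configuration. -/
lemma exists_toppled_finset {τ σ : {v : V // v ≠ s} → ℕ}
    (h : Relation.ReflTransGen (SandTopple G s) τ σ) :
    ∃ T : Finset V, (∀ v : {v : V // v ≠ s}, (v : V) ∉ T → τ v ≤ σ v) ∧
      ∀ F ⊆ T, F.Nonempty →
        ∃ v : {v : V // v ≠ s}, (v : V) ∈ F ∧ (F.filter (G.Adj v)).card ≤ σ v := by
  induction h with
  | refl =>
    exact ⟨∅, fun _ _ => le_rfl, fun F hF hn => absurd (Finset.subset_empty.1 hF) hn.ne_empty⟩
  | @tail σ σ' _ hstep ih =>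
    obtain ⟨T, hT, hforb⟩ := ih
    obtain ⟨w, hw, rfl⟩ := hstep
    refine ⟨insert (w : V) T, fun v hv => ?_, fun F hF hn => ?_⟩
    · rw [Finset.mem_insert, not_or] at hv
      have hvw : v ≠ w := fun h => hv.1 (congrArg _ h)
      have := hT v hv.2
      simp only [hvw, if_false]
      omega
    · rcases (F.erase (w : V)).eq_empty_or_nonempty with he | he
      · have hFw : F = {(w : V)} := by
          rcases Finset.erase_eq_empty_iff F (w : V) |>.1 he with h | h
          · exact absurd h hn.ne_empty
          · exact h
        refine ⟨w, by simp [hFw], ?_⟩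
        have : F.filter (G.Adj w) = ∅ := by
          rw [hFw, Finset.filter_singleton, if_neg (G.loopless.irrefl _)]
        simp [this]
      · obtain ⟨v, hv, hle⟩ := hforb (F.erase (w : V)) (Finset.subset_insert_iff.1 hF) he
        rw [Finset.mem_erase] at hv
        refine ⟨v, hv.2, ?_⟩
        have hvw : v ≠ w := fun h => hv.1 (congrArg _ h)
        simp only [hvw, if_false]
        refine le_trans ?_ (Nat.add_le_add_right hle _)
        rw [Finset.filter_erase]
        split_ifs with hadj
        · have := Finset.pred_card_le_card_erase (s := F.filter (G.Adj v)) (a := (w : V))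
          omega
        · rw [Finset.erase_eq_of_notMem (by simp [hadj])]
          simp

lemma SandRecurrent.noForbidden {σ : {v : V // v ≠ s} → ℕ} (h : SandRecurrent G s σ) :
    NoForbidden G s σ := by
  obtain ⟨hst, hrec⟩ := h
  obtain ⟨ξ, hξ⟩ := hrec fun v => G.degree v
  obtain ⟨T, hT, hforb⟩ := exists_toppled_finset hξ
  intro F hs hn
  refine hforb F (fun x hx => ?_) hn
  by_contra hxT
  have hxs : x ≠ s := by rintro rfl; exact hs hx
  have h1 := hT ⟨x, hxs⟩ hxT
  have h2 := hst ⟨x, hxs⟩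
  exact absurd ((Nat.le_add_right _ _).trans h1) h2.not_ge

/-- If the script `f` takes `c` to a configuration without forbidden subconfigurations,
then it can be carried out by legal topplings. -/
lemma reflTransGen_of_script {σ : {v : V // v ≠ s} → ℕ} (hσ : NoForbidden G s σ) (n : ℕ) :
    ∀ (f : V → ℕ) (c : {v : V // v ≠ s} → ℕ), f s = 0 → ∑ v, f v = n →
      (∀ v : {v : V // v ≠ s}, c v + ∑ u ∈ G.neighborFinset v, f u =
        σ v + G.degree (v : V) * f v) →
      Relation.ReflTransGen (SandTopple G s) c σ := by
  induction n with
  | zero =>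
    intro f c _ hsum hc
    have hf : ∀ v, f v = 0 := by simpa using hsum
    have : c = σ := funext fun v => by simpa [hf] using hc v
    rw [this]
  | succ n ih =>
    intro f c hfs hsum hc
    obtain ⟨m, -, hm⟩ := Finset.exists_max_image Finset.univ f ⟨s, Finset.mem_univ s⟩
    have hm0 : 0 < f m := by
      by_contra h0
      have : ∑ v, f v = 0 := Finset.sum_eq_zero fun v hv => by have := hm v hv; omega
      omega
    obtain ⟨v, hv, hle⟩ := hσ (Finset.univ.filter fun v => f v = f m)
      (by simp only [Finset.mem_filter, Finset.mem_univ, true_and]; omega) ⟨m, by simp⟩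
    simp only [Finset.mem_filter, Finset.mem_univ, true_and] at hv
    have hsumle : ∑ u ∈ G.neighborFinset v, f u + G.degree (v : V) ≤
        G.degree (v : V) * f v + σ v := by
      have h1 : ∑ u ∈ G.neighborFinset (v : V), (f u + 1) ≤
          ∑ u ∈ G.neighborFinset (v : V), (f v + if f u = f m then 1 else 0) := by
        refine Finset.sum_le_sum fun u _ => ?_
        have := hm u (Finset.mem_univ u)
        split_ifs <;> omega
      have h2 : ((G.neighborFinset (v : V)).filter fun u => f u = f m).card ≤ σ v := by
        refine le_trans (Finset.card_le_card ?_) hle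
        intro u
        simp
        tauto
      rw [Finset.sum_add_distrib, Finset.sum_add_distrib, ← Finset.card_filter] at h1
      simp only [Finset.sum_const, SimpleGraph.card_neighborFinset_eq_degree, smul_eq_mul,
        mul_one] at h1
      omega
    have hlegal : G.degree (v : V) ≤ c v := by
      have := hc v
      omega
    obtain ⟨g, hg⟩ : ∃ g : V → ℕ, f = g + Pi.single (v : V) 1 := by
      refine ⟨f - Pi.single (v : V) 1, ?_⟩
      ext u
      by_cases hu : u = v
      · subst hu; simp; omega
      · simp [hu]
    have hsingle : ∀ u : V, ∑ w ∈ G.neighborFinset u, f w =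
        ∑ w ∈ G.neighborFinset u, g w + if G.Adj u v then 1 else 0 := by
      intro u
      simp [hg, Finset.sum_add_distrib]
    refine Relation.ReflTransGen.head ⟨v, hlegal, rfl⟩ (ih g _ ?_ ?_ ?_)
    · have := congrFun hg s
      simp only [Pi.add_apply] at this
      omega
    · rw [hg] at hsum
      simpa [Finset.sum_add_distrib] using hsum
    · intro u
      have hcu := hc u
      rw [hsingle] at hcu
      by_cases huv : u = v
      · subst huv
        have hfg : f u = g u + 1 := by simp [hg]
        simp only [SimpleGraph.irrefl, if_false, hfg, mul_add] at hcu
        simp only [if_true]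
        omega
      · have hfg : f u = g u := by
          have : (u : V) ≠ v := fun h => huv (Subtype.ext h)
          simp [hg, this]
        rw [hfg] at hcu
        simp only [huv, if_false]
        omega

lemma sandRecurrent_iff (hconn : G.Connected) (σ : {v : V // v ≠ s} → ℕ) :
    SandRecurrent G s σ ↔ SandStable G s σ ∧ NoForbidden G s σ := by
  refine ⟨fun h => ⟨h.1, h.noForbidden⟩, fun ⟨hst, hσ⟩ => ⟨hst, fun η => ?_⟩⟩
  obtain ⟨f, hfs, hf⟩ := exists_superharmonic_script (s := s) hconn
  set N := ∑ v, η v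
  have hN : ∀ v : {v : V // v ≠ s},
      N * ∑ u ∈ G.neighborFinset (v : V), f u + η v ≤ G.degree (v : V) * (N * f v) := by
    intro v
    have h1 : η v ≤ N := Finset.single_le_sum (fun _ _ => Nat.zero_le _) (Finset.mem_univ v)
    have h2 := Nat.mul_le_mul_left N (hf v v.2)
    rw [mul_add, mul_one, mul_left_comm] at h2
    omega
  refine ⟨fun v => σ v + G.degree (v : V) * (N * f v) -
    N * ∑ u ∈ G.neighborFinset (v : V), f u - η v, ?_⟩
  refine reflTransGen_of_script hσ _ (fun v => N * f v) _ (by simp [hfs]) rfl fun v => ?_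
  have := hN v
  rw [← Finset.mul_sum, Pi.add_apply]
  omega

lemma card_outNeighbors_add_card_filter {F : Finset V} (v : V) :
    (outNeighbors G.edgeFinset F v).card + (F.filter (G.Adj v)).card = G.degree v := by
  rw [← SimpleGraph.card_neighborFinset_eq_degree,
    ← Finset.card_filter_add_card_filter_not (s := G.neighborFinset v) (fun u => u ∉ F)]
  refine congrArg₂ _ (congrArg _ ?_) (congrArg _ ?_)
  · ext u
    simp [mem_outNeighbors, and_comm]
  · ext u
    simp [and_comm]

lemma finsum_recurrent_eq_finsum_parkingFunctions (G : SimpleGraph V) [DecidableRel G.Adj]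
    (s : V) (hconn : G.Connected) (j : ℕ) :
    ∑ᶠ σ ∈ {σ : {v : V // v ≠ s} → ℕ | SandRecurrent G s σ},
        (((∑ v : {v : V // v ≠ s}, (σ v : ℤ)) - G.edgeFinset.card + G.degree s).toNat.choose j)
    = ∑ᶠ k ∈ parkingFunctions {s} G.edgeFinset,
        (G.edgeFinset.card - ∑ u, k u).choose j := by
  obtain ⟨e, hes, hev⟩ : ∃ e : ({v : V // v ≠ s} → ℕ) → V → ℕ, (∀ σ, e σ s = 0) ∧
      ∀ σ (v : {v : V // v ≠ s}), e σ v = G.degree (v : V) - σ v :=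
    ⟨fun σ v => if h : v = s then 0 else G.degree v - σ ⟨v, h⟩, fun σ => by simp,
      fun σ v => by simp [v.2]⟩
  refine finsum_mem_eq_of_bijOn e ⟨?_, ?_, ?_⟩ ?_
  · intro σ hσ
    rw [Set.mem_ofPred_eq, sandRecurrent_iff hconn] at hσ
    refine ⟨fun u => ?_, fun F hd hn => ?_⟩
    · by_cases hu : u = s
      · subst hu; simp [hes]
      · have h1 := hev σ ⟨u, hu⟩
        have h2 := hσ.1 ⟨u, hu⟩
        simp only at h1 h2
        simp only [Finset.mem_singleton, hu, iff_false]
        omega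
    · obtain ⟨v, hv, hle⟩ := hσ.2 F (by simpa using hd) hn
      refine ⟨v, hv, ?_⟩
      have := card_outNeighbors_add_card_filter (G := G) (F := F) v
      rw [hev]
      omega
  · intro σ hσ τ hτ heq
    ext v
    have h := congrFun heq v
    have h1 := hσ.1 v
    have h2 := hτ.1 v
    rw [hev, hev] at h
    omega
  · rintro k ⟨hk, hF⟩
    have hdeg : ∀ v, v ≠ s → k v ≤ G.degree v := by
      intro v hv
      obtain ⟨w, hw, hle⟩ := hF {v} (by simpa using hv) (Finset.singleton_nonempty v)
      obtain rfl := Finset.mem_singleton.1 hw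
      have := card_outNeighbors_add_card_filter (G := G) (F := {w}) w
      omega
    refine ⟨fun v => G.degree (v : V) - k v, ?_, ?_⟩
    · rw [Set.mem_ofPred_eq, sandRecurrent_iff hconn]
      refine ⟨fun v => ?_, fun F hs hn => ?_⟩
      · have h1 : k v ≠ 0 := fun h => v.2 (by simpa using (hk v).1 h)
        have h2 := hdeg v v.2
        simp only
        omega
      · obtain ⟨v, hv, hle⟩ := hF F (by simpa using hs) hn
        have hvs : v ≠ s := by rintro rfl; exact hs hv
        refine ⟨⟨v, hvs⟩, hv, ?_⟩
        have := card_outNeighbors_add_card_filter (G := G) (F := F) v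
        change (F.filter (G.Adj v)).card ≤ G.degree v - k v
        omega
    · ext v
      by_cases hv : v = s
      · rw [hv, (hk s).2 (Finset.mem_singleton_self s)]
        exact hes _
      · have h1 := hev (fun v => G.degree (v : V) - k v) ⟨v, hv⟩
        have h2 := hdeg v hv
        simp only at h1
        omega
  · intro σ hσ
    have h1 : ∑ u, e σ u + ∑ v, σ v = ∑ v : {v : V // v ≠ s}, G.degree (v : V) := by
      rw [Fintype.sum_eq_add_sum_subtype_ne _ s, hes, zero_add, ← Finset.sum_add_distrib]
      refine Finset.sum_congr rfl fun v _ => ?_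
      rw [hev, Nat.sub_add_cancel (hσ.1 v).le]
    have h2 := G.sum_degrees_eq_twice_card_edges
    rw [Fintype.sum_eq_add_sum_subtype_ne _ s] at h2
    rw [← Nat.cast_sum]
    congr 1
    omega

end Sandpile

/-- For a finite connected simple graph with at least two vertices, sink `s`, and
`j ≥ 0`: `Σ_{σ recurrent} C(level(σ), j)` equals the number of edge subsets `A` with
`|A| = |V| − 1 + j` whose spanning subgraph `(V,A)` is connected, where
`level(σ) = Σ_v σ(v) − |E| + deg(s)`. -/
theorem stmt_14 {V : Type*} [Fintype V] [DecidableEq V] (G : SimpleGraph V)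
    [DecidableRel G.Adj] (s : V)
    (hV : 1 < Fintype.card V) (hconn : G.Connected) (j : ℕ) :
    ∑ᶠ σ ∈ {σ : {v : V // v ≠ s} → ℕ | SandRecurrent G s σ},
        (((∑ v : {v : V // v ≠ s}, (σ v : ℤ)) - G.edgeFinset.card + G.degree s).toNat.choose j)
    = (Finset.univ.filter (fun A : Finset (Sym2 V) =>
        (A : Set (Sym2 V)) ⊆ G.edgeSet ∧
        A.card = Fintype.card V - 1 + j ∧
        (SimpleGraph.fromEdgeSet (A : Set (Sym2 V))).Connected)).card := by
  rw [finsum_recurrent_eq_finsum_parkingFunctions G s hconn, finsum_parkingFunctions_choose]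
  congr 1
  ext A
  have hA : A ∈ G.edgeFinset.powerset ↔ (A : Set (Sym2 V)) ⊆ G.edgeSet := by
    rw [Finset.mem_powerset, ← Finset.coe_subset, SimpleGraph.coe_edgeFinset]
  have hs : ({s}ᶜ : Finset V).card = Fintype.card V - 1 := by
    rw [Finset.card_compl, Finset.card_singleton]
  rw [Finset.mem_filter, Finset.mem_filter, hA, connected_fromEdgeSet_iff A s, hs]
  simp only [Finset.mem_univ, true_and]
  tauto
end

section
/- For every positive rational number β with β ≠ 1/2, the real number arccos(1/(2β+1)) / (2π·√(β² + β)) is transcendental over ℚ. (For β = 1/2 this number equals 1/√27, which is algebraic.) -/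
section GelfondSchneider

open Finset NumberField
open scoped NumberField

theorem iteratedDeriv_sub_pow_mul_self (w : ℂ) (n : ℕ) {g : ℂ → ℂ} (hg : Differentiable ℂ g) :
    iteratedDeriv n (fun z ↦ (z - w) ^ n * g z) w = n.factorial * g w := by
  induction n generalizing g with
  | zero => simp
  | succ n ih =>
    have hd : deriv (fun z ↦ (z - w) ^ (n + 1) * g z) =
        fun z ↦ (z - w) ^ n * ((n + 1) * g z + (z - w) * deriv g z) := by
      funext z
      have h := (((hasDerivAt_id z).sub_const w).pow (n + 1)).mul (hg z).hasDerivAt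
      refine (h.congr_of_eventuallyEq (.of_forall fun y ↦ by simp)).deriv.trans ?_
      simp
      ring
    rw [iteratedDeriv_succ', hd, ih]
    · push_cast [Nat.factorial_succ]
      ring
    · have := hg.deriv
      fun_prop

theorem exists_differentiable_eq_sub_pow_mul (w : ℂ) (n : ℕ) {f : ℂ → ℂ}
    (hf : Differentiable ℂ f) (h : n ≤ analyticOrderAt f w) :
    ∃ g : ℂ → ℂ, Differentiable ℂ g ∧ f = (fun z ↦ (z - w) ^ n * g z) := by
  induction n with
  | zero => exact ⟨f, hf, by simp⟩
  | succ n ih =>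
    obtain ⟨g, hg, rfl⟩ := ih (le_trans (by gcongr; simp) h)
    have hgw : g w = 0 := by
      have h0 := (natCast_le_analyticOrderAt_iff_iteratedDeriv_eq_zero (hf.analyticAt w)).1 h n
        (by simp)
      rw [iteratedDeriv_sub_pow_mul_self w n hg] at h0
      simpa [Nat.factorial_ne_zero] using h0
    refine ⟨dslope g w, ?_, ?_⟩
    · rw [← differentiableOn_univ] at hg ⊢
      exact (Complex.differentiableOn_dslope Filter.univ_mem).2 hg
    · funext z
      have := sub_smul_dslope g w z
      simp only [smul_eq_mul, hgw, sub_zero] at this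
      rw [← this]
      ring

theorem exists_differentiable_eq_prod_sub_pow_mul (P : Finset ℂ) (n : ℕ) {f : ℂ → ℂ}
    (hf : Differentiable ℂ f) (h : ∀ w ∈ P, n ≤ analyticOrderAt f w) :
    ∃ g : ℂ → ℂ, Differentiable ℂ g ∧ f = (fun z ↦ (∏ w ∈ P, (z - w) ^ n) * g z) := by
  induction P using Finset.induction_on with
  | empty => exact ⟨f, hf, by simp⟩
  | insert w P hw ih =>
    obtain ⟨g, hg, rfl⟩ := ih fun v hv ↦ h v (mem_insert_of_mem hv)
    have hP : Differentiable ℂ fun z ↦ ∏ v ∈ P, (z - v) ^ n := by fun_prop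
    have h0 : analyticOrderAt (fun z ↦ ∏ v ∈ P, (z - v) ^ n) w = 0 := by
      rw [(hP.analyticAt w).analyticOrderAt_eq_zero, prod_ne_zero_iff]
      intro v hv
      refine pow_ne_zero _ (sub_ne_zero.2 ?_)
      rintro rfl
      exact hw hv
    have h1 := h w (mem_insert_self _ _)
    have h2 := analyticOrderAt_mul (hP.analyticAt w) (hg.analyticAt w)
    rw [h0, zero_add] at h2
    obtain ⟨k, hk, rfl⟩ := exists_differentiable_eq_sub_pow_mul w n hg (h2 ▸ h1)
    refine ⟨k, hk, ?_⟩
    funext z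
    rw [prod_insert hw]
    ring

theorem norm_iteratedDeriv_le_of_le_analyticOrderAt {P : Finset ℂ} {n : ℕ} {f : ℂ → ℂ}
    (hf : Differentiable ℂ f) (h : ∀ w ∈ P, n ≤ analyticOrderAt f w) {m x M : ℝ} (hm : 1 ≤ m)
    (hx : 0 < x) (hP : ∀ w ∈ P, ‖w‖ ≤ m) (hP' : ∀ v ∈ P, ∀ w ∈ P, ‖v - w‖ ≤ m)
    (hM : ∀ z, ‖z‖ ≤ m + x → ‖f z‖ ≤ M) {v : ℂ} (hv : v ∈ P) :
    ‖iteratedDeriv n f v‖ ≤ n.factorial * (m ^ n) ^ #P * (M / (x ^ n) ^ #P) := by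
  obtain ⟨g, hg, rfl⟩ := exists_differentiable_eq_prod_sub_pow_mul P n hf h
  have hgv : ‖g v‖ ≤ M / (x ^ n) ^ #P := by
    refine Complex.norm_le_of_forall_mem_frontier_norm_le (U := Metric.ball 0 (m + x))
      Metric.isBounded_ball hg.diffContOnCl (fun z hz ↦ ?_) (subset_closure ?_)
    · rw [frontier_ball _ (by linarith), mem_sphere_zero_iff_norm] at hz
      rw [le_div_iff₀ (by positivity), mul_comm]
      refine le_trans ?_ (hM z hz.le)
      rw [norm_mul, norm_prod]
      gcongr
      rw [← prod_const]
      refine prod_le_prod (fun _ _ ↦ by positivity) fun w hw ↦ ?_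
      rw [norm_pow]
      gcongr
      have := norm_sub_norm_le z w
      linarith [hP w hw]
    · rw [mem_ball_zero_iff]
      linarith [hP v hv]
  have hfac : (fun z ↦ (∏ w ∈ P, (z - w) ^ n) * g z) =
      fun z ↦ (z - v) ^ n * ((∏ w ∈ P.erase v, (z - w) ^ n) * g z) := by
    funext z
    rw [← mul_prod_erase P _ hv, mul_assoc]
  rw [hfac, iteratedDeriv_sub_pow_mul_self v n (by fun_prop), norm_mul, norm_mul, norm_prod,
    ← mul_assoc, RCLike.norm_natCast]
  gcongr
  calc ∏ w ∈ P.erase v, ‖(v - w) ^ n‖ ≤ (m ^ n) ^ #(P.erase v) := by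
        rw [← prod_const]
        refine prod_le_prod (fun _ _ ↦ by positivity) fun w hw ↦ ?_
        rw [norm_pow]
        gcongr
        exact hP' v hv w (mem_of_mem_erase hw)
    _ ≤ (m ^ n) ^ #P := by
        gcongr
        · exact one_le_pow₀ hm
        · exact erase_subset _ _

theorem exists_siegel_house_le (K : Type*) [Field K] [NumberField K] :
    ∃ C : ℝ, 1 ≤ C ∧ ∀ (n m q : ℕ), 0 < n * m → q * q = 2 * (n * m) →
      ∀ (a : Matrix (Fin n × Fin m) (Fin q × Fin q) (𝓞 K)), a ≠ 0 → ∀ A : ℝ,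
      (∀ k l, house (a k l : K) ≤ A) →
      ∃ ξ : Fin q × Fin q → 𝓞 K, ξ ≠ 0 ∧ a.mulVec ξ = 0 ∧
        ∀ l, house (ξ l : K) ≤ C * q ^ 2 * A := by
  classical
  obtain ⟨c, hc⟩ : ∃ c : ℝ, ∀ (n m q : ℕ), 0 < n * m → q * q = 2 * (n * m) →
      ∀ (a : Matrix (Fin n × Fin m) (Fin q × Fin q) (𝓞 K)), a ≠ 0 → ∀ A : ℝ,
      (∀ k l, house (a k l : K) ≤ A) →
      ∃ ξ : Fin q × Fin q → 𝓞 K, ξ ≠ 0 ∧ a.mulVec ξ = 0 ∧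
        ∀ l, house (ξ l : K) ≤
          c * (c * (2 * (n * m) : ℕ) * A) ^ (((n * m : ℕ) : ℝ) / ((2 * (n * m) : ℕ) - (n * m : ℕ))) :=
    ⟨_, fun n m q hp hq a ha A hA ↦ NumberField.house.exists_ne_zero_int_vec_house_le K a ha hp
      (by lia) (by simp [hq]) hA (by simp)⟩
  refine ⟨max 1 (c * c), le_max_left .., fun n m q hp hq a ha A hA ↦ ?_⟩
  obtain ⟨ξ, h0, h1, h2⟩ := hc n m q hp hq a ha A hA
  have hA0 : 0 ≤ A := by
    contrapose! ha
    ext k l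
    exact absurd ((house_nonneg _).trans (hA k l)) ha.not_ge
  refine ⟨ξ, h0, h1, fun l ↦ (h2 l).trans ?_⟩
  have hexp : ((n * m : ℕ) : ℝ) / ((2 * (n * m) : ℕ) - (n * m : ℕ)) = 1 := by
    have : ((n * m : ℕ) : ℝ) ≠ 0 := by exact_mod_cast hp.ne'
    rw [Nat.cast_mul 2 (n * m)]
    rw [div_eq_one_iff_eq] <;> push_cast at this ⊢ <;> ring_nf
    exact this
  rw [hexp, Real.rpow_one, ← hq]
  push_cast
  calc _ = c * c * q ^ 2 * A := by ring
    _ ≤ _ := by gcongr; exact le_max_right ..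

theorem eq_zero_of_sum_mul_pow_eq_zero {ι F : Type*} [Fintype ι] [Field F] {v : ι → F}
    (hv : Function.Injective v) {u : ι → F} (h : ∀ k : ℕ, ∑ i, u i * v i ^ k = 0) : u = 0 := by
  let e := Fintype.equivFin ι
  have := Matrix.eq_zero_of_forall_pow_sum_mul_pow_eq_zero (f := v ∘ e.symm) (v := u ∘ e.symm)
    (hv.comp e.symm.injective) fun k ↦ by
      rw [← h k]
      exact e.symm.sum_comp fun i ↦ u i * v i ^ (k : ℕ)
  funext i
  simpa using congrFun this (e i)

/-- The value at `l` of the `k`-th derivative of `exp ((a + b * β) * z * log α)`, divided by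
`(log α) ^ k`, where `i = (a, b)` and `γ = α ^ β`. -/
def expEntry {K : Type*} [Field K] (α β γ : K) {q : ℕ} (k l : ℕ) (i : Fin q × Fin q) : K :=
  ((i.1 : ℕ) + (i.2 : ℕ) * β) ^ k * (α ^ (i.1 : ℕ) * γ ^ (i.2 : ℕ)) ^ l

theorem isIntegral_natCast_pow_mul_pow {K : Type*} [Field K] {c : ℕ} {x : K}
    (hx : IsIntegral ℤ (c * x)) {k n : ℕ} (hk : k ≤ n) : IsIntegral ℤ ((c : K) ^ n * x ^ k) := by
  have h : (c : K) ^ n * x ^ k = (c : K) ^ (n - k) * (c * x) ^ k := by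
    rw [mul_pow, ← mul_assoc, ← pow_add, Nat.sub_add_cancel hk]
  rw [h]
  have hc : IsIntegral ℤ (c : K) := by
    simpa using isIntegral_algebraMap (R := ℤ) (A := K) (x := (c : ℤ))
  exact (hc.pow _).mul (hx.pow k)

theorem isIntegral_mul_expEntry {K : Type*} [Field K] {α β γ : K} {c : ℕ}
    (hα : IsIntegral ℤ (c * α)) (hβ : IsIntegral ℤ (c * β)) (hγ : IsIntegral ℤ (c * γ))
    {q n m k l : ℕ} (hk : k ≤ n) (hl : l ≤ m) (i : Fin q × Fin q) :
    IsIntegral ℤ ((c : K) ^ (n + 2 * q * m) * expEntry α β γ k l i) := by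
  have hnat (a : ℕ) : IsIntegral ℤ (a : K) := by
    simpa using isIntegral_algebraMap (R := ℤ) (A := K) (x := (a : ℤ))
  have h1 : IsIntegral ℤ (c * (((i.1 : ℕ) : K) + (i.2 : ℕ) * β)) := by
    rw [show (c : K) * (((i.1 : ℕ) : K) + (i.2 : ℕ) * β) =
      c * (i.1 : ℕ) + (i.2 : ℕ) * (c * β) by ring]
    exact ((hnat c).mul (hnat i.1)).add ((hnat i.2).mul hβ)
  have h2 : IsIntegral ℤ (((c ^ (2 * q) : ℕ) : K) * (α ^ (i.1 : ℕ) * γ ^ (i.2 : ℕ))) := by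
    rw [show ((c ^ (2 * q) : ℕ) : K) * (α ^ (i.1 : ℕ) * γ ^ (i.2 : ℕ)) =
      c ^ q * α ^ (i.1 : ℕ) * (c ^ q * γ ^ (i.2 : ℕ)) by push_cast; ring]
    exact (isIntegral_natCast_pow_mul_pow hα i.1.2.le).mul
      (isIntegral_natCast_pow_mul_pow hγ i.2.2.le)
  have h3 := (isIntegral_natCast_pow_mul_pow h1 hk).mul (isIntegral_natCast_pow_mul_pow h2 hl)
  push_cast at h3
  rw [expEntry, pow_add, pow_mul, mul_mul_mul_comm]
  exact h3

theorem house_pow_le_of_le {K : Type*} [Field K] [NumberField K] {x : K} {B : ℝ} (hB : 1 ≤ B)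
    (hx : house x ≤ B) {k n : ℕ} (hk : k ≤ n) : house (x ^ k) ≤ B ^ n :=
  (house_pow_le x k).trans <| (pow_le_pow_left₀ (house_nonneg x) hx k).trans <|
    pow_le_pow_right₀ hB hk

theorem house_natCast (K : Type*) [Field K] [NumberField K] (a : ℕ) : house (a : K) = a := by
  simpa using house_intCast (K := K) a

theorem house_expEntry_le {K : Type*} [Field K] [NumberField K] {α β γ : K} {B : ℝ} (hB : 1 ≤ B)
    (hα : house α ≤ B) (hβ : house β ≤ B) (hγ : house γ ≤ B)
    {q n m k l : ℕ} (hk : k ≤ n) (hl : l ≤ m) (i : Fin q × Fin q) :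
    house (expEntry α β γ k l i) ≤ (2 * q * B) ^ n * B ^ (2 * q * m) := by
  have h1 : house (((i.1 : ℕ) : K) + (i.2 : ℕ) * β) ≤ 2 * q * B := by
    refine (house_add_le _ _).trans ?_
    rw [house_natCast, house_nat_mul]
    have h3 : ((i.1 : ℕ) : ℝ) ≤ q := by exact_mod_cast i.1.2.le
    have h4 : ((i.2 : ℕ) : ℝ) ≤ q := by exact_mod_cast i.2.2.le
    calc ((i.1 : ℕ) : ℝ) + (i.2 : ℕ) * house β ≤ q * 1 + q * B := by
          rw [mul_one]; gcongr; exact house_nonneg _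
      _ ≤ q * B + q * B := by gcongr
      _ = _ := by ring
  have h2 : house (α ^ (i.1 : ℕ) * γ ^ (i.2 : ℕ)) ≤ B ^ (2 * q) := by
    refine (house_mul_le _ _).trans ?_
    rw [two_mul, pow_add]
    gcongr
    · exact house_nonneg _
    · exact house_pow_le_of_le hB hα i.1.2.le
    · exact house_pow_le_of_le hB hγ i.2.2.le
  have hq : (1 : ℝ) ≤ q := by exact_mod_cast i.1.pos
  refine (house_mul_le _ _).trans ?_
  rw [pow_mul]
  gcongr
  · exact house_nonneg _
  · exact house_pow_le_of_le (by nlinarith) h1 hk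
  · exact house_pow_le_of_le (one_le_pow₀ hB) h2 hl

theorem exists_one_le_house_le {K : Type*} [Field K] [NumberField K] (α β γ : K) (c : ℕ) :
    ∃ B : ℝ, 1 ≤ B ∧ house α ≤ B ∧ house β ≤ B ∧ house γ ≤ B ∧ c ≤ B := by
  have := house_nonneg α
  have := house_nonneg β
  have := house_nonneg γ
  have := Nat.cast_nonneg (α := ℝ) c
  refine ⟨1 + house α + house β + house γ + c, ?_, ?_, ?_, ?_, ?_⟩ <;> linarith

theorem two_mul_mul_sq_le_four_mul_pow {m s : ℕ} (hm : 0 < m) (hs : 0 < s) :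
    (2 * m * s : ℝ) ^ 2 ≤ (4 * m) ^ (2 * m * s ^ 2) := by
  have hn : 2 * m * s ^ 2 ≠ 0 := by positivity
  have h1 : ((2 * m * s ^ 2 : ℕ) : ℝ) ≤ 2 ^ (2 * m * s ^ 2) := by
    exact_mod_cast Nat.lt_two_pow_self.le
  have h2 : (1 : ℝ) ≤ 2 * m := by
    have : (1 : ℝ) ≤ m := by exact_mod_cast hm
    linarith
  calc (2 * m * s : ℝ) ^ 2 = (2 * m) * (2 * m * s ^ 2 : ℕ) := by push_cast; ring
    _ ≤ (2 * m) ^ (2 * m * s ^ 2) * 2 ^ (2 * m * s ^ 2) := by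
        gcongr
        exact le_self_pow₀ h2 hn
    _ = _ := by rw [← mul_pow]; ring

theorem exists_auxiliary_coefficients {K : Type*} [Field K] [NumberField K] {α β γ : K} {c : ℕ}
    (hc : 0 < c)
    (hcα : IsIntegral ℤ (c * α)) (hcβ : IsIntegral ℤ (c * β)) (hcγ : IsIntegral ℤ (c * γ))
    {m : ℕ} (hm : 0 < m) :
    ∃ E : ℝ, 1 ≤ E ∧ ∀ s : ℕ, 0 < s → ∃ η : Fin (2 * m * s) × Fin (2 * m * s) → 𝓞 K, η ≠ 0 ∧
      (∀ k < 2 * m * s ^ 2, ∀ l < m, ∑ i, (η i : K) * expEntry α β γ k l i = 0) ∧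
      ∀ i, house (η i : K) ≤ (E * s) ^ (2 * m * s ^ 2) := by
  obtain ⟨C, hC, hS⟩ := exists_siegel_house_le K
  obtain ⟨B, hB, hα, hβ, hγ, hcB⟩ := exists_one_le_house_le α β γ c
  have hm1 : (1 : ℝ) ≤ m := by exact_mod_cast hm
  refine ⟨C * (4 * m) * B ^ (1 + 2 * m) * (4 * m * B) * B ^ (2 * m), ?_, fun s hs ↦ ?_⟩
  · have h4 : (1 : ℝ) ≤ 4 * m := by linarith
    have := one_le_mul_of_one_le_of_one_le h4 hB
    have h5 := one_le_pow₀ (n := 1 + 2 * m) hB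
    have h6 := one_le_pow₀ (n := 2 * m) hB
    exact one_le_mul_of_one_le_of_one_le (one_le_mul_of_one_le_of_one_le
      (one_le_mul_of_one_le_of_one_le (one_le_mul_of_one_le_of_one_le hC h4) h5) this) h6
  have hqn : 2 * m * s ≤ 2 * m * s ^ 2 := by
    gcongr
    exact Nat.le_self_pow (by simp) s
  have hsq := two_mul_mul_sq_le_four_mul_pow hm hs
  have hpos : 0 < 2 * m * s ^ 2 := by positivity
  have hqpos : 0 < 2 * m * s := by positivity
  have hqm : (2 * m * s) * (2 * m * s) = 2 * ((2 * m * s ^ 2) * m) := by ring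
  have hqR : ((2 * m * s : ℕ) : ℝ) = 2 * m * s := by push_cast; rfl
  generalize 2 * m * s ^ 2 = n at *
  generalize 2 * m * s = q at *
  let a : Matrix (Fin n × Fin m) (Fin q × Fin q) (𝓞 K) := fun k i ↦
    ⟨_, isIntegral_mul_expEntry hcα hcβ hcγ k.1.2.le k.2.2.le i⟩
  have ha : a ≠ 0 := by
    intro h
    have h3 := congrArg (algebraMap (𝓞 K) K) (congrFun (congrFun h (⟨0, hpos⟩, ⟨0, hm⟩))
      (⟨0, hqpos⟩, ⟨0, hqpos⟩))
    have h4 : (c : K) ^ (n + 2 * q * m) * expEntry α β γ 0 0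
      ((⟨0, hqpos⟩, ⟨0, hqpos⟩) : Fin q × Fin q) = 0 := h3.trans (map_zero _)
    simp [expEntry, hc.ne'] at h4
  have hA (k i) : house (a k i : K) ≤
      B ^ (n + 2 * q * m) * ((2 * q * B) ^ n * B ^ (2 * q * m)) := by
    change house ((c : K) ^ (n + 2 * q * m) * expEntry α β γ k.1 k.2 i) ≤ _
    refine (house_mul_le _ _).trans ?_
    gcongr
    · exact house_nonneg _
    · exact house_pow_le_of_le hB (by rwa [house_natCast]) le_rfl
    · exact house_expEntry_le hB hα hβ hγ k.1.2.le k.2.2.le i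
  obtain ⟨η, h0, h1, h2⟩ := hS n m q (by positivity) hqm a ha _ hA
  refine ⟨η, h0, fun k hk l hl ↦ ?_, fun i ↦ (h2 i).trans ?_⟩
  · have h3 := congrArg (algebraMap (𝓞 K) K) (congrFun h1 (⟨k, hk⟩, ⟨l, hl⟩))
    have hcK : (c : K) ^ (n + 2 * q * m) ≠ 0 := by
      have : (c : K) ≠ 0 := by exact_mod_cast hc.ne'
      exact pow_ne_zero _ this
    refine (mul_eq_zero_iff_left hcK).1 ?_
    rw [mul_sum]
    simp only [Matrix.mulVec, dotProduct, map_sum, map_mul, Pi.zero_apply, map_zero] at h3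
    rw [← h3]
    refine sum_congr rfl fun i _ ↦ ?_
    change _ = (c : K) ^ (n + 2 * q * m) * expEntry α β γ k l i * (η i : K)
    ring
  · have h3 : B ^ (2 * q * m) ≤ (B ^ (2 * m)) ^ n := by
      rw [← pow_mul]
      refine pow_le_pow_right₀ hB ?_
      nlinarith [Nat.mul_le_mul_left m hqn]
    calc C * q ^ 2 * (B ^ (n + 2 * q * m) * ((2 * q * B) ^ n * B ^ (2 * q * m)))
        ≤ C ^ n * (4 * m) ^ n * ((B ^ n * (B ^ (2 * m)) ^ n) * ((2 * q * B) ^ n *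
          (B ^ (2 * m)) ^ n)) := by
          rw [pow_add]
          gcongr
          · exact le_self_pow₀ hC hpos.ne'
          · rw [hqR]
            exact hsq
      _ = _ := by
          rw [hqR]
          simp only [← mul_pow]
          ring

theorem iteratedDeriv_sum_mul_exp {ι : Type*} [Fintype ι] (u w : ι → ℂ) (k : ℕ) :
    iteratedDeriv k (fun z ↦ ∑ i, u i * Complex.exp (w i * z)) =
      fun z ↦ ∑ i, u i * w i ^ k * Complex.exp (w i * z) := by
  induction k with
  | zero => simp
  | succ k ih =>
    rw [iteratedDeriv_succ, ih]
    funext z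
    refine HasDerivAt.deriv (HasDerivAt.fun_sum fun i _ ↦ ?_)
    have h := (((hasDerivAt_id z).const_mul (w i)).cexp.const_mul (u i * w i ^ k))
    refine h.congr_deriv ?_
    simp only [id]
    ring

theorem sum_mul_exp_eq_map_sum_expEntry {K : Type*} [Field K] (σ : K →+* ℂ) {α β γ : K} {t : ℂ}
    (hα : Complex.exp t = σ α) (hγ : Complex.exp (σ β * t) = σ γ) {q : ℕ}
    (η : Fin q × Fin q → K) (k l : ℕ) :
    ∑ i, σ (η i) * (((i.1 : ℕ) + (i.2 : ℕ) * σ β) * t) ^ k *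
      Complex.exp (((i.1 : ℕ) + (i.2 : ℕ) * σ β) * t * l) =
    t ^ k * σ (∑ i, η i * expEntry α β γ k l i) := by
  rw [map_sum, mul_sum]
  refine sum_congr rfl fun i _ ↦ ?_
  have h : Complex.exp (((i.1 : ℕ) + (i.2 : ℕ) * σ β) * t * l) =
      (σ α ^ (i.1 : ℕ) * σ γ ^ (i.2 : ℕ)) ^ l := by
    rw [← hα, ← hγ, ← Complex.exp_nat_mul, ← Complex.exp_nat_mul, ← Complex.exp_add,
      ← Complex.exp_nat_mul]
    ring_nf
  rw [h, expEntry]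
  simp only [map_mul, map_pow, map_add, map_natCast]
  rw [mul_pow _ t]
  ring

theorem injective_natCast_add_natCast_mul {K : Type*} [Field K] [CharZero K] {β : K}
    (hβ : ∀ x : ℚ, (x : K) ≠ β) (q : ℕ) :
    Function.Injective fun i : Fin q × Fin q ↦ ((i.1 : ℕ) + (i.2 : ℕ) * β : K) := by
  rintro ⟨a, b⟩ ⟨a', b'⟩ h
  simp only at h
  have hb : b = b' := by
    by_contra hne
    have hne' : ((b : ℕ) : K) - (b' : ℕ) ≠ 0 := by
      rw [sub_ne_zero]
      exact_mod_cast fun h ↦ hne (Fin.ext h)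
    refine hβ ((((a' : ℕ) : ℚ) - (a : ℕ)) / ((b : ℕ) - (b' : ℕ))) ?_
    push_cast
    rw [div_eq_iff hne']
    linear_combination -h
  subst hb
  have ha : ((a : ℕ) : K) = (a' : ℕ) := by linear_combination h
  rw [Fin.ext (Nat.cast_injective ha)]

theorem exists_sum_mul_expEntry_ne_zero {K : Type*} [Field K] [CharZero K] {α β γ : K}
    (hβ : ∀ x : ℚ, (x : K) ≠ β) {q : ℕ} {η : Fin q × Fin q → K} (hη : η ≠ 0) :
    ∃ k, ∑ i, η i * expEntry α β γ k 0 i ≠ 0 := by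
  contrapose! hη
  exact eq_zero_of_sum_mul_pow_eq_zero (injective_natCast_add_natCast_mul hβ q) fun k ↦ by
    simpa [expEntry] using hη k

theorem one_le_norm_mul_pow_of_house_le {K : Type*} [Field K] [NumberField K] (σ : K →+* ℂ)
    {y : K} (hy : IsIntegral ℤ y) (hy0 : y ≠ 0) {H : ℝ} (hH : house y ≤ H) :
    1 ≤ ‖σ y‖ * H ^ (Module.finrank ℚ K - 1) := by
  have h1 : (1 : ℝ) ≤ ‖Algebra.norm ℚ y‖ := by
    obtain ⟨z, hz⟩ := IsIntegrallyClosed.isIntegral_iff.1 (Algebra.isIntegral_norm ℚ hy)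
    have hz0 : z ≠ 0 := by
      rintro rfl
      exact (Algebra.norm_ne_zero_iff.2 hy0) (by rw [← hz, map_zero])
    rw [← hz]
    simpa [← Int.norm_eq_abs] using (mod_cast Int.one_le_abs hz0 : (1 : ℝ) ≤ |(z : ℝ)|)
  refine h1.trans ((norm_norm_le_norm_mul_house_pow y σ).trans ?_)
  gcongr
  exact house_nonneg _

theorem house_mul_sum_expEntry_le {K : Type*} [Field K] [NumberField K] {α β γ : K} {c : ℕ} {B : ℝ}
    (hB : 1 ≤ B) (hα : house α ≤ B) (hβ : house β ≤ B) (hγ : house γ ≤ B) (hc : c ≤ B)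
    {q m r l : ℕ} {D X : ℝ} {η : Fin q × Fin q → K} (hη : ∀ i, house (η i) ≤ D) (hl : l ≤ m)
    (hqr : q ≤ r) (hqX : q ≤ 2 * m * X) (hq : (q : ℝ) ^ 2 ≤ (4 * m) ^ r) (hD : 0 ≤ D) :
    house ((c : K) ^ (r + 2 * q * m) * ∑ i, η i * expEntry α β γ r l i) ≤
      (B * B ^ (2 * m)) ^ r * ((4 * m) ^ r * (D * ((2 * (2 * m * X) * B) ^ r *
        (B ^ (2 * m)) ^ r))) := by
  have hBm : B ^ (2 * q * m) ≤ (B ^ (2 * m)) ^ r := by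
    rw [← pow_mul]
    refine pow_le_pow_right₀ hB ?_
    nlinarith [Nat.mul_le_mul_left m hqr]
  refine (house_mul_le _ _).trans ?_
  gcongr
  · exact house_nonneg _
  · calc house ((c : K) ^ (r + 2 * q * m)) ≤ B ^ (r + 2 * q * m) :=
          house_pow_le_of_le hB (by rwa [house_natCast]) le_rfl
      _ ≤ _ := by rw [pow_add, mul_pow]; gcongr
  · calc house (∑ i, η i * expEntry α β γ r l i)
        ≤ ∑ i : Fin q × Fin q, D * ((2 * (2 * m * X) * B) ^ r * (B ^ (2 * m)) ^ r) := by
          refine (house_sum_le_sum_house _ _).trans (sum_le_sum fun i _ ↦ ?_)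
          refine (house_mul_le _ _).trans ?_
          gcongr
          · exact house_nonneg _
          · exact hη i
          · refine (house_expEntry_le hB hα hβ hγ le_rfl hl i).trans ?_
            have : 0 ≤ 2 * m * X := (Nat.cast_nonneg q).trans hqX
            gcongr
      _ = (q : ℝ) ^ 2 * (D * ((2 * (2 * m * X) * B) ^ r * (B ^ (2 * m)) ^ r)) := by
          simp [sq]
      _ ≤ _ := by
          gcongr
          have : 0 ≤ 2 * m * X := (Nat.cast_nonneg q).trans hqX
          positivity

theorem norm_map_sum_expEntry_le {K : Type*} [Field K] (σ : K →+* ℂ) {α β γ : K}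
    {t : ℂ} (hα : Complex.exp t = σ α) (hγ : Complex.exp (σ β * t) = σ γ)
    {q m r l : ℕ} {D X : ℝ} {η : Fin q × Fin q → K} (hη : ∀ i, ‖σ (η i)‖ ≤ D) (hD : 0 ≤ D) (hl : l < m)
    (h0 : ∀ k < r, ∀ l < m, ∑ i, η i * expEntry α β γ k l i = 0) (hX : 1 ≤ X) (hXr : X ^ 2 = r)
    (hqX : q ≤ 2 * m * X) (hq : (q : ℝ) ^ 2 ≤ (4 * m) ^ r) :
    ‖t‖ ^ r * ‖σ (∑ i, η i * expEntry α β γ r l i)‖ ≤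
      (X ^ 2) ^ r * ((m : ℝ) ^ r) ^ m * ((4 * m) ^ r * D *
        Real.exp (2 * m * (m + 1) * (1 + ‖σ β‖) * ‖t‖) ^ r / (X ^ r) ^ m) := by
  have hm : (1 : ℝ) ≤ m := by exact_mod_cast Nat.one_le_of_lt hl
  let w : Fin q × Fin q → ℂ := fun i ↦ ((i.1 : ℕ) + (i.2 : ℕ) * σ β) * t
  let f : ℂ → ℂ := fun z ↦ ∑ i, σ (η i) * Complex.exp (w i * z)
  have hf : Differentiable ℂ f := by fun_prop
  have hd (k l : ℕ) : iteratedDeriv k f l = t ^ k * σ (∑ i, η i * expEntry α β γ k l i) := by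
    rw [iteratedDeriv_sum_mul_exp, ← sum_mul_exp_eq_map_sum_expEntry σ hα hγ]
  have hw (i : Fin q × Fin q) : ‖w i‖ ≤ q * (1 + ‖σ β‖) * ‖t‖ := by
    rw [norm_mul]
    gcongr
    refine (norm_add_le _ _).trans ?_
    rw [norm_mul, Complex.norm_natCast, Complex.norm_natCast, mul_add, mul_one]
    have h3 : ((i.1 : ℕ) : ℝ) ≤ q := by exact_mod_cast i.1.2.le
    have h4 : ((i.2 : ℕ) : ℝ) ≤ q := by exact_mod_cast i.2.2.le
    gcongr
  have hfM : ∀ z : ℂ, ‖z‖ ≤ m + X → ‖f z‖ ≤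
      (4 * m) ^ r * D * Real.exp (2 * m * (m + 1) * (1 + ‖σ β‖) * ‖t‖) ^ r := by
    intro z hz
    have hterm (i : Fin q × Fin q) : ‖σ (η i) * Complex.exp (w i * z)‖ ≤
        D * Real.exp (2 * m * (m + 1) * (1 + ‖σ β‖) * ‖t‖) ^ r := by
      rw [norm_mul, ← Real.exp_nat_mul]
      gcongr
      · exact hη i
      refine (Complex.norm_exp_le_exp_norm _).trans (Real.exp_le_exp.2 ?_)
      rw [norm_mul]
      calc ‖w i‖ * ‖z‖ ≤ (2 * m * X * (1 + ‖σ β‖) * ‖t‖) * (m * X + X) := by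
            gcongr
            · exact (hw i).trans (by gcongr)
            · refine hz.trans ?_
              gcongr
              exact le_mul_of_one_le_right (by positivity) hX
        _ = _ := by rw [← hXr]; ring
    calc ‖f z‖ ≤ ∑ i : Fin q × Fin q,
          D * Real.exp (2 * m * (m + 1) * (1 + ‖σ β‖) * ‖t‖) ^ r :=
          norm_sum_le_of_le _ fun i _ ↦ hterm i
      _ = (q : ℝ) ^ 2 * (D * Real.exp (2 * m * (m + 1) * (1 + ‖σ β‖) * ‖t‖) ^ r) := by
          simp [sq]
      _ ≤ _ := by
          rw [mul_assoc ((4 * m : ℝ) ^ r)]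
          gcongr
  let P : Finset ℂ := (range m).image Nat.cast
  have hP : #P = m := by
    rw [card_image_of_injective _ Nat.cast_injective, card_range]
  have hmem {v : ℂ} (hv : v ∈ P) : ∃ j < m, (j : ℂ) = v := by simpa [P] using hv
  have hmain := norm_iteratedDeriv_le_of_le_analyticOrderAt (P := P) (n := r) hf
    (fun v hv ↦ ?_) hm (zero_lt_one.trans_le hX) (fun v hv ↦ ?_) (fun v hv w hw ↦ ?_) hfM
    (v := (l : ℂ)) (mem_image_of_mem _ (mem_range.2 hl))
  · rw [hd, norm_mul, norm_pow, hP] at hmain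
    refine hmain.trans ?_
    gcongr
    rw [hXr]
    exact_mod_cast r.factorial_le_pow
  · obtain ⟨j, hj, rfl⟩ := hmem hv
    refine (natCast_le_analyticOrderAt_iff_iteratedDeriv_eq_zero (hf.analyticAt _)).2 fun k hk ↦ ?_
    rw [hd, h0 k hk j hj]
    simp
  · obtain ⟨j, hj, rfl⟩ := hmem hv
    rw [Complex.norm_natCast]
    exact_mod_cast hj.le
  · obtain ⟨j, hj, rfl⟩ := hmem hv
    obtain ⟨j', hj', rfl⟩ := hmem hw
    have hj1 : (j : ℝ) ≤ m := by exact_mod_cast hj.le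
    have hj1' : (j' : ℝ) ≤ m := by exact_mod_cast hj'.le
    rw [← Complex.ofReal_natCast, ← Complex.ofReal_natCast, ← Complex.ofReal_sub, Complex.norm_real,
      Real.norm_eq_abs, abs_le]
    constructor <;> linarith [Nat.cast_nonneg (α := ℝ) j, Nat.cast_nonneg (α := ℝ) j']

theorem false_of_exp_eq_of_exp_mul_eq {K : Type*} [Field K] [NumberField K] (σ : K →+* ℂ)
    {α β γ : K} {t : ℂ} (ht : t ≠ 0) (hα : Complex.exp t = σ α)
    (hγ : Complex.exp (σ β * t) = σ γ) (hβ : ∀ x : ℚ, (x : K) ≠ β) : False := by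
  classical
  obtain ⟨c, hc, hcαβγ⟩ : ∃ c : ℕ, 0 < c ∧ ∀ x ∈ ({α, β, γ} : Finset K), IsIntegral ℤ (c * x) := by
    obtain ⟨y, hy, h⟩ := exists_integral_multiples ℤ ℚ ({α, β, γ} : Finset K)
    refine ⟨y.natAbs, Int.natAbs_pos.2 hy, fun x hx ↦ ?_⟩
    have h := h x hx
    rcases Int.natAbs_eq y with hy | hy
    · rw [hy] at h
      simpa using h
    · rw [hy] at h
      simpa using h.neg
  simp only [mem_insert, mem_singleton, forall_eq_or_imp, forall_eq] at hcαβγ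
  obtain ⟨hcα, hcβ, hcγ⟩ := hcαβγ
  obtain ⟨B, hB, hBα, hBβ, hBγ, hBc⟩ := exists_one_le_house_le α β γ c
  obtain ⟨d, hd⟩ : ∃ d, d = Module.finrank ℚ K - 1 := ⟨_, rfl⟩
  obtain ⟨m, hm⟩ : ∃ m, m = 2 * d + 4 := ⟨_, rfl⟩
  have hm0 : 0 < m := by lia
  have hm1 : (1 : ℝ) ≤ m := by exact_mod_cast hm0
  obtain ⟨E, hE, hη⟩ := exists_auxiliary_coefficients hc hcα hcβ hcγ hm0
  let G := Real.exp (2 * m * (m + 1) * (1 + ‖σ β‖) * ‖t‖)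
  let F := B * B ^ (2 * m) * (4 * m) * E * (2 * (2 * m) * B) * B ^ (2 * m)
  let Q := B * B ^ (2 * m) * m ^ m * (4 * m) * E * G * F ^ d
  obtain ⟨s, hs⟩ := exists_nat_gt (max 1 (Q / ‖t‖))
  have hs1 : (1 : ℝ) < s := (le_max_left _ _).trans_lt hs
  have hs0 : 0 < s := by exact_mod_cast zero_lt_one.trans hs1
  obtain ⟨η, hη0, hηz, hηE⟩ := hη s hs0
  obtain ⟨r, ⟨l, hl, hr⟩, hmin⟩ : ∃ r, (∃ l < m, ∑ i, (η i : K) * expEntry α β γ r l i ≠ 0) ∧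
      ∀ k < r, ∀ l < m, ∑ i, (η i : K) * expEntry α β γ k l i = 0 := by
    have hex : ∃ r, ∃ l < m, ∑ i, (η i : K) * expEntry α β γ r l i ≠ 0 := by
      have hη0' : (fun i ↦ (η i : K)) ≠ 0 := fun h ↦ hη0 <| by
        funext i
        simpa using congrFun h i
      obtain ⟨k, hk⟩ := exists_sum_mul_expEntry_ne_zero (α := α) (γ := γ) hβ hη0'
      exact ⟨k, 0, hm0, hk⟩
    refine ⟨Nat.find hex, Nat.find_spec hex, fun k hk l hl ↦ ?_⟩
    by_contra h
    exact Nat.find_min hex hk ⟨l, hl, h⟩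
  have hnr : 2 * m * s ^ 2 ≤ r := by
    by_contra! h
    exact hr (hηz r h l hl)
  have hsr : s ^ 2 ≤ r := le_trans (Nat.le_mul_of_pos_left _ (by positivity)) hnr
  have hqr : 2 * m * s ≤ r := by
    refine le_trans ?_ hnr
    gcongr
    exact Nat.le_self_pow (by simp) s
  have hr0 : r ≠ 0 := by
    have : 0 < s ^ 2 := by positivity
    lia
  obtain ⟨X, hXr, hX0⟩ : ∃ X : ℝ, X ^ 2 = r ∧ 0 ≤ X :=
    ⟨√r, Real.sq_sqrt (Nat.cast_nonneg r), Real.sqrt_nonneg _⟩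
  have hsX : (s : ℝ) ≤ X := by
    refine le_of_sq_le_sq ?_ hX0
    rw [hXr]
    exact_mod_cast hsr
  have hX1 : 1 ≤ X := hs1.le.trans hsX
  have hηX (i) : house (η i : K) ≤ (E * X) ^ r :=
    calc house (η i : K) ≤ (E * s) ^ (2 * m * s ^ 2) := hηE i
      _ ≤ (E * X) ^ (2 * m * s ^ 2) := by gcongr
      _ ≤ (E * X) ^ r := pow_le_pow_right₀ (one_le_mul_of_one_le_of_one_le hE hX1) hnr
  have hqX : ((2 * m * s : ℕ) : ℝ) ≤ 2 * m * X := by push_cast; gcongr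
  have hq2 : ((2 * m * s : ℕ) : ℝ) ^ 2 ≤ (4 * m) ^ r := by
    push_cast
    exact (two_mul_mul_sq_le_four_mul_pow hm0 hs0).trans (pow_le_pow_right₀ (by linarith) hnr)
  have hD : 0 ≤ (E * X) ^ r := by positivity
  have hH := house_mul_sum_expEntry_le hB hBα hBβ hBγ hBc hηX hl.le hqr hqX hq2 hD
  have hS := norm_map_sum_expEntry_le σ hα hγ
    (fun i ↦ (norm_embedding_le_house (η i : K) σ).trans (hηX i)) hD hl hmin hX1 hXr hqX hq2
  set ρ := ∑ i, (η i : K) * expEntry α β γ r l i with hρ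
  have hint : IsIntegral ℤ ((c : K) ^ (r + 2 * (2 * m * s) * m) * ρ) := by
    rw [hρ, mul_sum]
    refine IsIntegral.sum _ fun i _ ↦ ?_
    rw [mul_left_comm]
    exact (η i).2.mul (isIntegral_mul_expEntry hcα hcβ hcγ le_rfl hl.le i)
  have hy0 : (c : K) ^ (r + 2 * (2 * m * s) * m) * ρ ≠ 0 :=
    mul_ne_zero (pow_ne_zero _ (by exact_mod_cast hc.ne')) hr
  have hHF : house ((c : K) ^ (r + 2 * (2 * m * s) * m) * ρ) ≤ (F * X ^ 2) ^ r := by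
    refine hH.trans_eq ?_
    simp only [← mul_pow]
    congr 1
    simp only [F]
    ring
  have hN := one_le_norm_mul_pow_of_house_le σ hint hy0 hHF
  have hcB : ‖σ ((c : K) ^ (r + 2 * (2 * m * s) * m))‖ ≤ (B * B ^ (2 * m)) ^ r := by
    rw [map_pow, map_natCast, norm_pow, Complex.norm_natCast]
    calc (c : ℝ) ^ (r + 2 * (2 * m * s) * m) ≤ B ^ (r + 2 * (2 * m * s) * m) := by gcongr
      _ ≤ B ^ ((1 + 2 * m) * r) := by
        refine pow_le_pow_right₀ hB ?_
        nlinarith [Nat.mul_le_mul_left m hqr]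
      _ = _ := by rw [pow_mul, pow_add, pow_one]
  have ht0 : 0 < ‖t‖ := norm_pos_iff.2 ht
  have hXpos : 0 < X := zero_lt_one.trans_le hX1
  have hF0 : 0 < F := by positivity
  have hpow : (‖t‖ * X ^ m) ^ r ≤ (Q * X ^ (2 * d + 3)) ^ r := by
    rw [← hd, map_mul, norm_mul] at hN
    calc (‖t‖ * X ^ m) ^ r = ‖t‖ ^ r * (X ^ r) ^ m * 1 := by ring
      _ ≤ _ := mul_le_mul_of_nonneg_left hN (by positivity)
      _ = (‖t‖ ^ r * ‖σ ρ‖) * (X ^ r) ^ m * ‖σ ((c : K) ^ (r + 2 * (2 * m * s) * m))‖ *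
          ((F * X ^ 2) ^ r) ^ d := by
        ring
      _ ≤ ((X ^ 2) ^ r * ((m : ℝ) ^ r) ^ m * ((4 * m) ^ r * (E * X) ^ r * G ^ r / (X ^ r) ^ m)) *
          (X ^ r) ^ m * (B * B ^ (2 * m)) ^ r * ((F * X ^ 2) ^ r) ^ d := by
        gcongr
      _ = ((X ^ 2) ^ r * ((m : ℝ) ^ r) ^ m * ((4 * m) ^ r * (E * X) ^ r * G ^ r)) *
          (B * B ^ (2 * m)) ^ r * ((F * X ^ 2) ^ r) ^ d := by
        field_simp
      _ = _ := by
        simp only [← pow_mul, mul_comm r]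
        simp only [pow_mul _ _ r, ← mul_pow]
        congr 1
        simp only [Q]
        ring
  have hle : ‖t‖ * X ^ m ≤ Q * X ^ (2 * d + 3) := le_of_pow_le_pow_left₀ hr0 (by positivity) hpow
  have hlt : Q < ‖t‖ * X := by
    have := ((le_max_right _ _).trans_lt hs).trans_le hsX
    rw [div_lt_iff₀ ht0] at this
    linarith
  rw [hm, show 2 * d + 4 = (2 * d + 3) + 1 by ring, pow_succ' X, ← mul_assoc] at hle
  exact absurd (le_of_mul_le_mul_right hle (by positivity)) hlt.not_ge

/-- The **Gelfond–Schneider theorem**. -/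
theorem transcendental_exp_mul_of_irrational {t b : ℂ} (ht : t ≠ 0)
    (hα : IsAlgebraic ℚ (Complex.exp t)) (hb : IsAlgebraic ℚ b) (hb' : ∀ x : ℚ, (x : ℂ) ≠ b) :
    Transcendental ℚ (Complex.exp (b * t)) := by
  intro hγ
  let S : Set ℂ := {Complex.exp t, b, Complex.exp (b * t)}
  have hS : ∀ x ∈ S, IsIntegral ℚ x := by
    rintro x (rfl | rfl | rfl)
    exacts [hα.isIntegral, hb.isIntegral, hγ.isIntegral]
  let K := IntermediateField.adjoin ℚ S
  have : FiniteDimensional ℚ K :=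
    IntermediateField.finiteDimensional_adjoin (S := S) hS
  have : NumberField K := { }
  have hmem (x) (hx : x ∈ S) : x ∈ K := IntermediateField.subset_adjoin ℚ S hx
  refine false_of_exp_eq_of_exp_mul_eq (algebraMap K ℂ) (α := ⟨_, hmem (Complex.exp t) (by simp [S])⟩)
    (β := ⟨b, hmem b (by simp [S])⟩) (γ := ⟨_, hmem (Complex.exp (b * t)) (by simp [S])⟩) ht rfl rfl
    fun x hx ↦ hb' x ?_
  simpa using congrArg (algebraMap K ℂ) hx

end GelfondSchneider

/-- For every positive rational `β ≠ 1/2`, the real number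
`arccos(1/(2β+1)) / (2π·√(β² + β))` is transcendental over `ℚ`. -/
theorem stmt_19 (β : ℚ) (hβ : 0 < β) (hβ' : β ≠ 1/2) :
    Transcendental ℚ
      (Real.arccos (1 / (2 * (β : ℝ) + 1)) /
        (2 * Real.pi * Real.sqrt ((β : ℝ) ^ 2 + (β : ℝ)))) := by
  intro halg
  have hβR : (0 : ℝ) < β := by exact_mod_cast hβ
  obtain ⟨θ, hθ⟩ : ∃ θ, θ = Real.arccos (1 / (2 * (β : ℝ) + 1)) := ⟨_, rfl⟩
  have hle : 1 / (2 * (β : ℝ) + 1) ≤ 1 := by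
    rw [div_le_one (by positivity)]
    linarith
  have hcos : Real.cos θ = 1 / (2 * (β : ℝ) + 1) := by
    rw [hθ, Real.cos_arccos (by linarith [show 0 < 1 / (2 * (β : ℝ) + 1) by positivity]) hle]
  rw [← hθ] at halg
  have hrat (q : ℚ) : IsAlgebraic ℚ (q : ℝ) := isAlgebraic_algebraMap q
  have hsqrt : IsAlgebraic ℚ (√((β : ℝ) ^ 2 + β)) := by
    refine IsAlgebraic.of_pow two_pos ?_
    rw [Real.sq_sqrt (by positivity)]
    exact ((hrat β).pow 2).add (hrat β)
  have hb : IsAlgebraic ℚ (θ / Real.pi) := by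
    have h := (halg.mul hsqrt).mul (hrat 2)
    have hs : √((β : ℝ) ^ 2 + β) ≠ 0 := by positivity
    have hpi := Real.pi_ne_zero
    refine (congrArg (IsAlgebraic ℚ) ?_).mp h
    push_cast
    field_simp
  have hirr (q : ℚ) : (q : ℝ) ≠ θ / Real.pi := by
    intro hq
    rw [eq_div_iff Real.pi_ne_zero] at hq
    have h := niven ⟨q, hq.symm⟩ ⟨1 / (2 * β + 1), by rw [hcos]; push_cast; rfl⟩
    have hpos : 0 < 1 / (2 * (β : ℝ) + 1) := by positivity
    have hlt : 1 / (2 * (β : ℝ) + 1) < 1 := by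
      rw [div_lt_one (by positivity)]
      linarith
    rw [hcos] at h
    rcases h with h | h | h | h | h
    · linarith
    · linarith
    · linarith
    · refine hβ' ?_
      rw [div_eq_div_iff (by positivity) (by norm_num)] at h
      have : (β : ℝ) = (1 / 2 : ℚ) := by push_cast; linarith
      exact_mod_cast this
    · have : 1 / (2 * (β : ℝ) + 1) = 1 := h
      linarith
  have hexp : Complex.exp (((θ / Real.pi : ℝ) : ℂ) * (Real.pi * Complex.I)) =
      Complex.exp (θ * Complex.I) := by
    congr 1
    push_cast
    field_simp
  refine transcendental_exp_mul_of_irrational (t := Real.pi * Complex.I)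
    (b := ((θ / Real.pi : ℝ) : ℂ)) (by simp [Real.pi_ne_zero]) ?_ (hb.algebraMap (A := ℂ))
    (fun q hq ↦ hirr q (by exact_mod_cast hq)) ?_
  · rw [Complex.exp_pi_mul_I]
    exact_mod_cast isAlgebraic_algebraMap (A := ℂ) (-1 : ℚ)
  · rw [hexp, Complex.exp_mul_I]
    have hcosA : IsAlgebraic ℚ (Real.cos θ) := by
      rw [hcos]
      simpa using hrat (1 / (2 * β + 1))
    have hsinA : IsAlgebraic ℚ (Real.sin θ) := by
      refine IsAlgebraic.of_pow two_pos ?_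
      rw [Real.sin_sq]
      exact isAlgebraic_one.sub (hcosA.pow 2)
    rw [← Complex.ofReal_cos, ← Complex.ofReal_sin]
    exact (hcosA.algebraMap (A := ℂ)).add
      ((hsinA.algebraMap (A := ℂ)).mul Complex.isIntegral_rat_I.isAlgebraic)
end
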